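/- arXiv:1206.2358 — 4 statements merged into one kernel-verified Lean document; each statement's English description precedes it below -/
import Mathlib

section
/- For an n×n matrix A over a commutative ring, the k-subdiscriminant sDisc_k(A), expressed as a polynomial in the entries of A, is homogeneous of degree (n−k)(n−k−1). -/
/-- The `k`-th subdiscriminant of a family of `n` roots `lam`. -/
noncomputable def sDiscVal {F : Type*} [CommRing F] (n k : ℕ) (lam : Fin n → F) : F :=
  ∑ s ∈ Finset.powersetCard (n - k) (Finset.univ : Finset (Fin n)),
    ∏ p ∈ (s ×ˢ s).filter (fun p => p.1 < p.2), (lam p.1 - lam p.2) ^ 2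

open MvPolynomial in
/-- Substituting homogeneous polynomials `g i` of degree `w i` turns weighted homogeneous
components into homogeneous components. -/
theorem aeval_weightedHomogeneousComponent {σ τ R : Type*} [CommRing R] {w : σ → ℕ}
    {g : σ → MvPolynomial τ R} (hg : ∀ i, (g i).IsHomogeneous (w i)) (d : ℕ)
    (Q : MvPolynomial σ R) :
    aeval g (weightedHomogeneousComponent w d Q) = homogeneousComponent d (aeval g Q) := by
  classical
  induction Q using MvPolynomial.induction_on' with
  | add p q hp hq => simp only [map_add, hp, hq]
  | monomial m r =>
    have hm : (aeval g (monomial m r)).IsHomogeneous (Finsupp.weight w m) := by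
      rw [aeval_monomial, algebraMap_eq, Finsupp.weight_apply, Finsupp.sum, Finsupp.prod]
      refine (IsHomogeneous.prod _ _ _ fun i _ => ?_).C_mul r
      rw [smul_eq_mul, mul_comm]
      exact (hg i).pow _
    rw [homogeneousComponent_of_mem hm,
      weightedHomogeneousComponent_of_mem (isWeightedHomogeneous_monomial w m r rfl)]
    split_ifs <;> simp

theorem filter_lt_product_eq_filter_lt_offDiag {ι : Type*} [LinearOrder ι] (s : Finset ι) :
    (s ×ˢ s).filter (fun p => p.1 < p.2) = s.offDiag.filter (fun p => p.1 < p.2) := by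
  ext p
  simp only [Finset.mem_filter, Finset.mem_product, Finset.mem_offDiag]
  exact ⟨fun h => ⟨⟨h.1.1, h.1.2, h.2.ne⟩, h.2⟩, fun h => ⟨⟨h.1.1, h.1.2.1⟩, h.2⟩⟩

open MvPolynomial in
theorem esymm_isHomogeneous_of_fintype {σ : Type*} [Fintype σ] (R : Type*) [CommRing R] (j : ℕ) :
    (esymm σ R j).IsHomogeneous j := by
  refine IsHomogeneous.sum _ _ _ fun s hs => ?_
  rw [← (Finset.mem_powersetCard.mp hs).2, Finset.card_eq_sum_ones]
  exact IsHomogeneous.prod _ _ _ fun i _ => isHomogeneous_X R i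

theorem prod_filter_lt_eq_prod_sym2 {ι M : Type*} [LinearOrder ι] [CommMonoid M]
    (s : Finset ι) (f : Sym2 ι → M) :
    ∏ p ∈ (s ×ˢ s).filter (fun p => p.1 < p.2), f s(p.1, p.2) =
      ∏ z ∈ s.sym2 with ¬ z.IsDiag, f z := by
  have h := Finset.sum_sym2_filter_not_isDiag (M := Additive M) s (fun z => Additive.ofMul (f z))
  rw [filter_lt_product_eq_filter_lt_offDiag]
  exact h.symm

theorem card_filter_lt_mul_two {ι : Type*} [LinearOrder ι] (s : Finset ι) :
    ((s ×ˢ s).filter (fun p => p.1 < p.2)).card * 2 = s.card * (s.card - 1) := by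
  have h := Finset.sum_sym2_filter_not_isDiag (M := ℕ) s (fun _ => 1)
  have himg : (s.sym2.filter fun z => ¬ z.IsDiag) = s.offDiag.image Sym2.mk.uncurry := by
    ext z
    induction z with
    | _ a b =>
      simp
      grind
  simp only [Finset.sum_const, smul_eq_mul, mul_one] at h
  rw [filter_lt_product_eq_filter_lt_offDiag, ← h, himg, mul_comm,
    Sym2.two_mul_card_image_offDiag, Finset.offDiag_card, Nat.mul_sub_one]

open MvPolynomial in
theorem aeval_sDiscVal_X {S : Type*} [CommRing S] (n k : ℕ) (g : Fin n → S) :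
    aeval g (sDiscVal n k (X : Fin n → MvPolynomial (Fin n) ℤ)) = sDiscVal n k g := by
  simp [sDiscVal]

theorem sDiscVal_comp_perm {F : Type*} [CommRing F] (n k : ℕ) (lam : Fin n → F)
    (e : Equiv.Perm (Fin n)) : sDiscVal n k (lam ∘ e) = sDiscVal n k lam := by
  let f (μ : Fin n → F) : Sym2 (Fin n) → F :=
    Sym2.lift ⟨fun i j => (μ i - μ j) ^ 2, fun i j => by ring⟩
  have hf (μ : Fin n → F) (s : Finset (Fin n)) := prod_filter_lt_eq_prod_sym2 s (f μ)
  simp only [f, Sym2.lift_mk] at hf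
  simp only [sDiscVal, hf]
  refine Finset.sum_equiv e.finsetCongr (by simp) fun s _ => ?_
  let e' : Sym2 (Fin n) ≃ Sym2 (Fin n) :=
    ⟨Sym2.map e, Sym2.map e.symm, fun z => by simp [Sym2.map_map], fun z => by simp [Sym2.map_map]⟩
  refine Finset.prod_equiv e' (fun z => ?_) (fun z _ => ?_)
  · induction z with | _ a b => simp [e']
  · induction z with | _ a b => simp [e']

open MvPolynomial in
theorem sDiscVal_X_isHomogeneous (n k : ℕ) :
    (sDiscVal n k (X : Fin n → MvPolynomial (Fin n) ℤ)).IsHomogeneous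
      ((n - k) * (n - k - 1)) := by
  refine IsHomogeneous.sum _ _ _ fun s hs => ?_
  rw [← (Finset.mem_powersetCard.mp hs).2, ← card_filter_lt_mul_two, ← smul_eq_mul,
    ← Finset.sum_const]
  exact IsHomogeneous.prod _ _ _ fun p _ =>
    ((isHomogeneous_X ℤ p.1).sub (isHomogeneous_X ℤ p.2)).pow 2

open MvPolynomial in
/-- The elementary symmetric polynomial of the eigenvalues, as a polynomial in the entries. -/
noncomputable def charpolyEsymm (n j : ℕ) : MvPolynomial (Fin n × Fin n) ℤ :=
  C ((-1) ^ j) * (Matrix.charpoly.univ ℤ (Fin n)).coeff (n - j)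

theorem charpolyEsymm_isHomogeneous {n j : ℕ} (hj : j ≤ n) :
    (charpolyEsymm n j).IsHomogeneous j :=
  (Matrix.charpoly.univ_coeff_isHomogeneous ℤ (Fin n) (n - j) j
    (by rw [Fintype.card_fin]; omega)).C_mul _

open MvPolynomial in
theorem aeval_charpolyEsymm {S : Type*} [CommRing S] {n j : ℕ} (hj : j ≤ n)
    (A : Matrix (Fin n) (Fin n) S) (lam : Fin n → S)
    (h : A.charpoly = ∏ i, (Polynomial.X - Polynomial.C (lam i))) :
    aeval (fun p : Fin n × Fin n => A p.1 p.2) (charpolyEsymm n j) =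
      aeval lam (esymm (Fin n) ℤ j) := by
  have hA := Matrix.charpoly.univ_coeff_eval₂Hom (Fin n) (algebraMap ℤ S)
    (fun p : Fin n × Fin n => A p.1 p.2) (n - j)
  have hv := Multiset.prod_X_sub_C_coeff (Finset.univ.val.map lam) (k := n - j) (by simp)
  have hn : n - (n - j) = j := by omega
  simp only [Multiset.map_map, Multiset.card_map, Finset.card_val, Finset.card_univ,
    Fintype.card_fin, hn] at hv
  have hA' : aeval (fun p : Fin n × Fin n => A p.1 p.2)
      ((Matrix.charpoly.univ ℤ (Fin n)).coeff (n - j)) = A.charpoly.coeff (n - j) := hA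
  rw [charpolyEsymm, map_mul, hA', h, aeval_esymm_eq_multiset_esymm]
  refine (congrArg _ hv).trans ?_
  simp [← mul_assoc, ← mul_pow]

open MvPolynomial in
/-- The `k`-subdiscriminant of an `n×n` matrix, expressed as a polynomial with integer
coefficients in the matrix entries, is homogeneous of degree `(n−k)(n−k−1)`. -/
theorem stmt3 (n k : ℕ) (hn : 1 ≤ n) (hk : k ≤ n - 1) :
    ∃ P : MvPolynomial (Fin n × Fin n) ℤ,
      P.IsHomogeneous ((n - k) * (n - k - 1)) ∧
      ∀ (A : Matrix (Fin n) (Fin n) ℂ) (lam : Fin n → ℂ),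
        A.charpoly = ∏ i, (Polynomial.X - Polynomial.C (lam i)) →
        MvPolynomial.eval (fun p => A p.1 p.2) (MvPolynomial.map (Int.castRingHom ℂ) P) =
          sDiscVal n k lam := by
  let d := (n - k) * (n - k - 1)
  let F : MvPolynomial (Fin n) ℤ := sDiscVal n k X
  have hsymm : F.IsSymmetric := fun e => by
    rw [rename_eq_aeval]
    exact (aeval_sDiscVal_X n k _).trans (sDiscVal_comp_perm n k X e)
  obtain ⟨Q, hQ⟩ := esymmAlgHom_surjective ℤ (σ := Fin n) (n := n) (by simp) ⟨F, hsymm⟩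
  have hQF : aeval (fun i : Fin n => esymm (Fin n) ℤ (i + 1)) Q = F := by
    rw [← esymmAlgHom_apply, hQ]
  let w : Fin n → ℕ := fun i => i + 1
  let Q' := weightedHomogeneousComponent w d Q
  have hQF' : aeval (fun i : Fin n => esymm (Fin n) ℤ (i + 1)) Q' = F := by
    rw [aeval_weightedHomogeneousComponent (fun i => esymm_isHomogeneous_of_fintype ℤ _), hQF]
    exact homogeneousComponent_eq_self (sDiscVal_X_isHomogeneous n k)
  refine ⟨aeval (fun i : Fin n => charpolyEsymm n (i + 1)) Q', ?_, fun A lam h => ?_⟩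
  · rw [aeval_weightedHomogeneousComponent (fun i => charpolyEsymm_isHomogeneous i.2)]
    exact homogeneousComponent_isHomogeneous _ _
  · rw [eval_map, ← aeval_sDiscVal_X, show sDiscVal n k X = F from rfl, ← hQF']
    change aeval (fun p : Fin n × Fin n => A p.1 p.2) _ = _
    simp only [← AlgHom.comp_apply, comp_aeval, aeval_charpolyEsymm (Fin.is_lt _) A lam h]
end

section
/- Let F be a field of characteristic zero, let D_k ⊆ Fⁿ be the set of points with at most n−k−1 distinct coordinates, and let I(D_k) be its vanishing ideal in F[x₁,…,xₙ]. Then every symmetric polynomial in I(D_k) has degree at least (n−k)(n−k−1), and the space of symmetric polynomials in I(D_k) that are homogeneous of degree (n−k)(n−k−1) is one-dimensional, spanned by Δ_{n,k} := Σ_{1≤i₁<⋯<i_{n−k}≤n} δ(x_{i₁},…,x_{i_{n−k}})². -/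
/-- `Δ_{n,k} := Σ_{1≤i₁<⋯<i_{n−k}≤n} δ(x_{i₁},…,x_{i_{n−k}})²`. -/
noncomputable def DeltaPoly (F : Type*) [CommRing F] (n k : ℕ) : MvPolynomial (Fin n) F :=
  ∑ s ∈ Finset.powersetCard (n - k) (Finset.univ : Finset (Fin n)),
    (∏ p ∈ (s ×ˢ s).filter (fun p => p.1 < p.2),
      (MvPolynomial.X p.1 - MvPolynomial.X p.2)) ^ 2

open MvPolynomial Finset

section Discriminant

variable {ι R : Type*} [LinearOrder ι] [CommRing R]

/-- The squared difference product `δ(x_i : i ∈ s)²`. -/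
def discr (x : ι → R) (s : Finset ι) : R :=
  (∏ p ∈ (s ×ˢ s).filter (fun p => p.1 < p.2), (x p.1 - x p.2)) ^ 2

@[simp]
theorem discr_empty (x : ι → R) : discr x ∅ = 1 := by
  simp [discr]

theorem discr_insert (x : ι → R) {a : ι} {s : Finset ι} (ha : a ∉ s) :
    discr x (insert a s) = (∏ j ∈ s, (x a - x j) ^ 2) * discr x s := by
  have key : ∀ j ∈ s, (x a - x j) ^ 2 =
      ((if a < j then x a - x j else 1) * (if j < a then x j - x a else 1)) ^ 2 := by
    intro j hj
    have hne : a ≠ j := fun h => ha (h ▸ hj)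
    rcases lt_or_gt_of_ne hne with h | h
    · simp [h, h.not_gt]
    · simp only [h, h.not_gt, if_true, if_false]
      ring
  rw [prod_congr rfl key]
  simp only [discr, prod_filter, prod_product, prod_insert ha, lt_irrefl, if_false, one_mul,
    prod_mul_distrib, prod_pow]
  ring

theorem discr_map {κ : Type*} [LinearOrder κ] (x : κ → R) (σ : ι ↪ κ) (s : Finset ι) :
    discr x (s.map σ) = discr (x ∘ σ) s := by
  induction s using Finset.induction_on with
  | empty => simp
  | insert a s ha ih =>
    rw [map_insert, discr_insert _ (by simpa using ha), discr_insert _ ha, ih, prod_map]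
    rfl

theorem map_discr {S : Type*} [CommRing S] {G : Type*} [FunLike G R S] [RingHomClass G R S]
    (φ : G) (x : ι → R) (s : Finset ι) : φ (discr x s) = discr (φ ∘ x) s := by
  simp [discr]

theorem discr_eq_zero (x : ι → R) {s : Finset ι} {i j : ι} (hi : i ∈ s) (hj : j ∈ s)
    (hij : i ≠ j) (h : x i = x j) : discr x s = 0 := by
  rw [← insert_erase hi, discr_insert _ (notMem_erase _ _),
    prod_eq_zero (mem_erase.2 ⟨hij.symm, hj⟩) (by simp [h]), zero_mul]

theorem discr_X_isHomogeneous (s : Finset ι) :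
    (discr (X : ι → MvPolynomial ι R) s).IsHomogeneous (#s * (#s - 1)) := by
  induction s using Finset.induction_on with
  | empty => simpa using isHomogeneous_one _ _
  | insert a s ha ih =>
    rw [discr_insert _ ha, card_insert_of_notMem ha]
    have h := (IsHomogeneous.prod s (fun j => (X a - X j : MvPolynomial ι R) ^ 2) (fun _ => 2)
      (fun j _ => ((isHomogeneous_X R a).sub (isHomogeneous_X R j)).pow 2)).mul ih
    convert h using 1
    rw [sum_const, smul_eq_mul, ← Nat.mul_add, Nat.add_sub_cancel, mul_comm (#s + 1)]
    rcases Nat.eq_zero_or_pos #s with h0 | h0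
    · simp [h0]
    · congr 1
      omega

end Discriminant

section DiscriminantSum

variable (F : Type*) [CommRing F] (n m : ℕ)

/-- The sum of the squared difference products of all `m`-subsets of the variables. -/
noncomputable def discrSum : MvPolynomial (Fin n) F :=
  ∑ s ∈ powersetCard m (univ : Finset (Fin n)), discr X s

theorem discrSum_isSymmetric : (discrSum F n m).IsSymmetric := by
  intro σ
  simp only [discrSum, map_sum, map_discr]
  conv_rhs => rw [← map_univ_equiv σ, powersetCard_map, sum_map]
  refine sum_congr rfl fun s _ => ?_
  simp only [RelEmbedding.coe_toEmbedding, mapEmbedding_apply, discr_map]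
  congr 1
  ext1 i
  simp

theorem discrSum_isHomogeneous : (discrSum F n m).IsHomogeneous (m * (m - 1)) := by
  refine IsHomogeneous.sum _ _ _ fun s hs => ?_
  rw [← (mem_powersetCard.1 hs).2]
  exact discr_X_isHomogeneous s

variable {F n m} in
theorem eval_discrSum (a : Fin n → F) :
    eval a (discrSum F n m) = ∑ s ∈ powersetCard m univ, discr a s := by
  simp only [discrSum, map_sum, map_discr]
  refine sum_congr rfl fun s _ => ?_
  congr 1
  ext1 i
  simp

variable {F n m} in
theorem eval_discrSum_eq_zero (a : Fin n → F) (ha : (Set.range a).ncard < m) :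
    eval a (discrSum F n m) = 0 := by
  classical
  rw [eval_discrSum]
  refine sum_eq_zero fun s hs => ?_
  have hc : #(univ.image a) < #s := by
    rw [(mem_powersetCard.1 hs).2, ← Set.ncard_coe_finset]
    simpa using ha
  obtain ⟨i, hi, j, hj, hij, h⟩ := exists_ne_map_eq_of_card_lt_of_maps_to hc
    (f := a) (fun i _ => by simp)
  exact discr_eq_zero a hi hj hij h

theorem discrSum_ne_zero [CharZero F] (h : m ≤ n) : discrSum F n m ≠ 0 := by
  intro h0
  have h1 := eval_discrSum (F := F) (m := m) (fun i : Fin n => ((i : ℤ) : F))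
  rw [h0, map_zero] at h1
  have h2 : (0 : F) = ((∑ s ∈ powersetCard m (univ : Finset (Fin n)),
      discr (fun i : Fin n => (i : ℤ)) s : ℤ) : F) := by
    rw [h1, Int.cast_sum]
    refine sum_congr rfl fun s _ => ?_
    exact (map_discr (Int.castRingHom F) _ s).symm
  refine (Int.cast_ne_zero (α := F)).2 (ne_of_gt ?_) h2.symm
  refine sum_pos (fun s _ => ?_) (powersetCard_nonempty.2 (by simpa using h))
  refine (sq_nonneg _).lt_of_ne' (pow_ne_zero 2 (prod_ne_zero_iff.2 fun p hp => ?_))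
  have := (mem_filter.1 hp).2
  exact sub_ne_zero.2 (by simpa using Fin.val_ne_of_ne this.ne)

theorem coeff_finSuccEquiv_discrSum (hm : m ≠ 0) :
    (finSuccEquiv F n (discrSum F (n + 1) (m + 1))).coeff (2 * m) = discrSum F n m := by
  classical
  nontriviality F
  have hX : finSuccEquiv F n ∘ X ∘ Fin.succ = Polynomial.C ∘ X := by
    ext1 i
    simp [finSuccEquiv_X_succ]
  have hs : ∀ s : Finset (Fin n), finSuccEquiv F n (discr X (s.map (Fin.succEmb n))) =
      Polynomial.C (discr X s) := by
    intro s
    rw [discr_map, map_discr, map_discr]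
    exact congrArg (discr · s) hX
  have h0 : ∀ s : Finset (Fin n), (0 : Fin (n + 1)) ∉ s.map (Fin.succEmb n) := by
    intro s
    simp
  have hu : (univ : Finset (Fin (n + 1))) = insert 0 (univ.map (Fin.succEmb n)) := by
    ext i
    cases i using Fin.cases <;> simp
  have hdisj : Disjoint (powersetCard (m + 1) (univ.map (Fin.succEmb n)))
      ((powersetCard m (univ.map (Fin.succEmb n))).image (insert 0)) := by
    rw [disjoint_left]
    intro s hs hs'
    obtain ⟨t, -, rfl⟩ := mem_image.1 hs'
    exact h0 _ ((mem_powersetCard.1 hs).1 (mem_insert_self _ _))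
  have hinj : Set.InjOn (insert (0 : Fin (n + 1)))
      (powersetCard m (univ.map (Fin.succEmb n)) : Set (Finset (Fin (n + 1)))) := by
    intro s hs t ht hst
    have hs0 : 0 ∉ s := fun h => h0 _ ((mem_powersetCard.1 hs).1 h)
    have ht0 : 0 ∉ t := fun h => h0 _ ((mem_powersetCard.1 ht).1 h)
    rw [← erase_insert hs0, ← erase_insert ht0, hst]
  rw [discrSum, hu, powersetCard_succ_insert (h0 _), sum_union hdisj, sum_image hinj,
    powersetCard_map, powersetCard_map, sum_map, sum_map]
  simp only [map_add, map_sum, map_mul, Polynomial.coeff_add, Polynomial.finsetSum_coeff,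
    RelEmbedding.coe_toEmbedding, mapEmbedding_apply, discr_insert _ (h0 _), hs]
  rw [sum_eq_zero, zero_add, discrSum]
  · refine sum_congr rfl fun s hs' => ?_
    rw [Polynomial.coeff_mul_C]
    convert one_mul _
    have hp : finSuccEquiv F n (∏ j ∈ s.map (Fin.succEmb n), (X 0 - X j) ^ 2) =
        ∏ j ∈ s, (Polynomial.X - Polynomial.C (X j : MvPolynomial (Fin n) F)) ^ 2 := by
      simp [finSuccEquiv_X_succ, finSuccEquiv_X_zero]
    have hmon : ∀ j ∈ s,
        ((Polynomial.X - Polynomial.C (X j : MvPolynomial (Fin n) F)) ^ 2).Monic :=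
      fun j _ => (Polynomial.monic_X_sub_C _).pow 2
    have hdeg : (∏ j ∈ s,
        (Polynomial.X - Polynomial.C (X j : MvPolynomial (Fin n) F)) ^ 2).natDegree = 2 * m := by
      rw [Polynomial.natDegree_prod_of_monic _ _ hmon]
      simp [(Polynomial.monic_X_sub_C _).natDegree_pow, (mem_powersetCard.1 hs').2, mul_comm]
    rw [hp, ← hdeg]
    exact (Polynomial.monic_prod_of_monic _ _ hmon).coeff_natDegree
  · intro s _
    rw [Polynomial.coeff_C, if_neg (by omega)]

end DiscriminantSum

section Derivative

variable {σ R : Type*} [CommRing R]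

theorem derivative_aeval [Fintype σ] (p : σ → Polynomial R) (f : MvPolynomial σ R) :
    (aeval p f).derivative = ∑ j, aeval p (pderiv j f) * (p j).derivative := by
  classical
  induction f using MvPolynomial.induction_on with
  | C a => simp [Polynomial.algebraMap_eq]
  | add f g hf hg => simp [hf, hg, add_mul, sum_add_distrib]
  | mul_X f i hf =>
    have h : ∀ j, aeval p (pderiv j (f * X i)) * (p j).derivative =
        aeval p (pderiv j f) * (p j).derivative * p i +
          if j = i then aeval p f * (p i).derivative else 0 := by
      intro j
      rw [pderiv_mul, map_add, map_mul, map_mul, aeval_X]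
      rcases eq_or_ne j i with rfl | hj
      · rw [pderiv_X_self, map_one, if_pos rfl]
        ring
      · rw [pderiv_X_of_ne hj.symm, map_zero, if_neg hj]
        ring
    rw [sum_congr rfl fun j _ => h j, sum_add_distrib, sum_ite_eq' univ i, if_pos (mem_univ i),
      ← sum_mul, ← hf, map_mul, aeval_X, Polynomial.derivative_mul]

theorem polynomial_eval_aeval (p : σ → Polynomial R) (f : MvPolynomial σ R) (t : R) :
    (aeval p f).eval t = eval (fun j => (p j).eval t) f := by
  rw [aeval_def, polynomial_eval_eval₂, eval, coe_eval₂Hom]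
  congr 1
  ext r
  simp [Polynomial.algebraMap_eq]

theorem MvPolynomial.IsSymmetric.eval_pderiv_eq {f : MvPolynomial σ R} (hf : f.IsSymmetric)
    {b : σ → R} {i j : σ} (h : b i = b j) : eval b (pderiv i f) = eval b (pderiv j f) := by
  classical
  have h1 := pderiv_rename (Equiv.swap i j).injective i f
  rw [hf, Equiv.swap_apply_left] at h1
  rw [h1, eval_rename]
  congr 2
  ext l
  simp only [Function.comp_apply, Equiv.swap_apply_def]
  split_ifs with h2 h3
  · rw [h2, h]
  · rw [h3, h]
  · rfl

end Derivative

/-- `f` vanishes at every point with at most `m` distinct coordinates. -/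
def VanishesOnFew {n : ℕ} {F : Type*} [CommRing F] (m : ℕ) (f : MvPolynomial (Fin n) F) : Prop :=
  ∀ a : Fin n → F, (Set.range a).ncard ≤ m → eval a f = 0

section Vanishing

variable {F : Type*} [Field F] [CharZero F] {n m : ℕ}

theorem VanishesOnFew.eval_pderiv {f : MvPolynomial (Fin n) F} (hv : VanishesOnFew m f)
    (hf : f.IsSymmetric) {b : Fin n → F} (hb : (Set.range b).ncard ≤ m) (i : Fin n) :
    eval b (pderiv i f) = 0 := by
  classical
  let p : Fin n → Polynomial F := fun j => if b j = b i then Polynomial.X else Polynomial.C (b j)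
  have hp : aeval p f = 0 := by
    refine Polynomial.funext fun t => ?_
    rw [polynomial_eval_aeval, Polynomial.eval_zero]
    refine hv _ (le_trans ?_ hb)
    have : (fun j => (p j).eval t) = (fun y => if y = b i then t else y) ∘ b := by
      ext j
      simp only [p, Function.comp_apply]
      split_ifs <;> simp
    rw [this, Set.range_comp]
    exact Set.ncard_image_le (Set.finite_range b)
  have hpe : (fun j => (p j).eval (b i)) = b := by
    ext j
    simp only [p]
    split_ifs with h <;> simp [h]
  have h1 := congrArg (Polynomial.eval (b i)) (derivative_aeval p f)
  rw [hp, Polynomial.derivative_zero, Polynomial.eval_zero, Polynomial.eval_finsetSum] at h1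
  have h2 : ∀ j ∈ univ, Polynomial.eval (b i) (aeval p (pderiv j f) * (p j).derivative) =
      if b j = b i then eval b (pderiv i f) else 0 := by
    intro j _
    rw [Polynomial.eval_mul, polynomial_eval_aeval, hpe]
    by_cases h : b j = b i
    · simp [p, h, hf.eval_pderiv_eq h]
    · simp [p, h]
  rw [sum_congr rfl h2, ← sum_filter, sum_const, nsmul_eq_mul] at h1
  refine (mul_eq_zero.1 h1.symm).resolve_left ?_
  exact Nat.cast_ne_zero.2 (card_ne_zero_of_mem (mem_filter.2 ⟨mem_univ i, rfl⟩))

theorem VanishesOnFew.coeff_finSuccEquiv {f : MvPolynomial (Fin (n + 1)) F}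
    (hv : VanishesOnFew (m + 1) f) (j : ℕ) : VanishesOnFew m ((finSuccEquiv F n f).coeff j) := by
  intro a ha
  have : (finSuccEquiv F n f).map (eval a) = 0 := by
    refine Polynomial.funext fun t => ?_
    rw [← eval_eq_eval_mv_eval', Polynomial.eval_zero]
    refine hv _ ?_
    rw [Fin.range_cons]
    exact (Set.ncard_insert_le _ _).trans (by omega)
  rw [← Polynomial.coeff_map, this, Polynomial.coeff_zero]

theorem VanishesOnFew.coeff_finSuccEquiv_of_coeff_eq_zero {f : MvPolynomial (Fin (n + 1)) F}
    (hv : VanishesOnFew m f) (hf : f.IsSymmetric)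
    (hc : ∀ j, 2 * m ≤ j → (finSuccEquiv F n f).coeff j = 0) (j : ℕ) :
    VanishesOnFew m ((finSuccEquiv F n f).coeff j) := by
  classical
  intro a ha
  rcases ha.lt_or_eq with ha' | ha'
  · obtain ⟨m, rfl⟩ : ∃ l, m = l + 1 := ⟨m - 1, by omega⟩
    exact hv.coeff_finSuccEquiv j a (by omega)
  let q := (finSuccEquiv F n f).map (eval a)
  suffices hq : q = 0 by
    rw [← Polynomial.coeff_map]
    exact (congrArg (Polynomial.coeff · j) hq).trans (Polynomial.coeff_zero j)
  by_contra hq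
  have hdeg : q.natDegree < 2 * m := by
    rw [Polynomial.natDegree_lt_iff_degree_lt hq, Polynomial.degree_lt_iff_coeff_zero]
    intro l hl
    rw [Polynomial.coeff_map, hc l hl, map_zero]
  let p : Fin (n + 1) → Polynomial F := Fin.cons Polynomial.X (Polynomial.C ∘ a)
  have hpe : ∀ t, (fun j => (p j).eval t) = (Fin.cons t a : Fin (n + 1) → F) := by
    intro t
    ext j
    cases j using Fin.cases <;> simp [p]
  have hqp : q = aeval p f := by
    refine Polynomial.funext fun t => ?_
    rw [polynomial_eval_aeval, hpe, eval_eq_eval_mv_eval']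
  have hcons : ∀ i, (Set.range (Fin.cons (a i) a : Fin (n + 1) → F)).ncard ≤ m := by
    intro i
    rw [Fin.range_cons, Set.insert_eq_of_mem (Set.mem_range_self i)]
    exact ha
  have hroot : ∀ i, 1 < q.rootMultiplicity (a i) := by
    intro i
    rw [Polynomial.one_lt_rootMultiplicity_iff_isRoot hq, Polynomial.IsRoot, Polynomial.IsRoot]
    constructor
    · rw [hqp, polynomial_eval_aeval, hpe]
      exact hv _ (hcons i)
    · rw [hqp, derivative_aeval, Polynomial.eval_finsetSum]
      refine sum_eq_zero fun j _ => ?_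
      rw [Polynomial.eval_mul, polynomial_eval_aeval, hpe, hv.eval_pderiv hf (hcons i), zero_mul]
  have hle : 2 • (univ.image a).val ≤ q.roots := by
    rw [Multiset.le_iff_count]
    intro y
    rw [Multiset.count_nsmul, Polynomial.count_roots]
    by_cases hy : y ∈ univ.image a
    · obtain ⟨i, -, rfl⟩ := mem_image.1 hy
      rw [Multiset.count_eq_one_of_mem (univ.image a).nodup hy]
      exact hroot i
    · rw [Multiset.count_eq_zero_of_notMem (by simpa using hy)]
      simp
  have hcard := (Multiset.card_le_card hle).trans q.card_roots'
  have hS : #(univ.image a) = m := by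
    rw [← ha', ← Set.ncard_coe_finset]
    simp
  rw [Multiset.card_nsmul, card_val, hS] at hcard
  omega

end Vanishing

section Symmetric

variable {R : Type*} [CommRing R] {n : ℕ}

theorem MvPolynomial.IsSymmetric.coeff_finSuccEquiv {f : MvPolynomial (Fin (n + 1)) R}
    (hf : f.IsSymmetric) (j : ℕ) : ((finSuccEquiv R n f).coeff j).IsSymmetric := by
  intro σ
  have h : ∀ g : MvPolynomial (Fin (n + 1)) R,
      finSuccEquiv R n (rename (Equiv.Perm.decomposeFin.symm (0, σ)) g) =
        (finSuccEquiv R n g).map (rename σ : _ →ₐ[R] _).toRingHom := by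
    intro g
    induction g using MvPolynomial.induction_on with
    | C a => simp [finSuccEquiv_apply]
    | add f g hf hg => simp only [map_add, hf, hg, Polynomial.map_add]
    | mul_X f i hf =>
      simp only [map_mul, hf, Polynomial.map_mul, rename_X]
      congr 1
      cases i using Fin.cases <;> simp [finSuccEquiv_X_zero, finSuccEquiv_X_succ]
  have h1 := congrArg (Polynomial.coeff · j) (h f)
  simp only [Polynomial.coeff_map] at h1
  rw [hf] at h1
  exact h1.symm

theorem MvPolynomial.IsSymmetric.totalDegree_eq_zero {f : MvPolynomial (Fin (n + 1)) R}
    (hf : f.IsSymmetric) (h : ∀ j, j ≠ 0 → (finSuccEquiv R n f).coeff j = 0) :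
    f.totalDegree = 0 := by
  rw [MvPolynomial.totalDegree_eq_zero_iff]
  have h0 : ∀ d ∈ f.support, d 0 = 0 := by
    intro d hd
    by_contra hne
    have := finSuccEquiv_coeff_coeff d.tail f (d 0)
    rw [h _ hne, Finsupp.cons_tail, coeff_zero] at this
    exact mem_support_iff.1 hd this.symm
  intro d hd i
  have h1 := coeff_rename_mapDomain (Equiv.swap 0 i) (Equiv.swap 0 i).injective f d
  rw [hf] at h1
  have h2 := h0 (d.mapDomain (Equiv.swap 0 i)) (mem_support_iff.2 (h1 ▸ mem_support_iff.1 hd))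
  have h3 := Finsupp.mapDomain_apply (Equiv.swap 0 i).injective d i
  rwa [Equiv.swap_apply_right, h2, eq_comm] at h3

end Symmetric

section Main

variable {F : Type*} [Field F]

theorem smul_discrSum_eq_zero {n m : ℕ} {c : F}
    (h : (c • discrSum F n m).totalDegree < m * (m - 1)) : c • discrSum F n m = 0 := by
  by_contra h0
  rw [smul_eq_C_mul] at h h0
  have := ((discrSum_isHomogeneous F n m).C_mul c).totalDegree h0
  omega

theorem vanishesOnFew_discrSum (n m : ℕ) : VanishesOnFew m (discrSum F n (m + 1)) :=
  fun a ha => eval_discrSum_eq_zero a (by omega)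

theorem exists_eq_smul_discrSum [CharZero F] (n m : ℕ) (f : MvPolynomial (Fin n) F)
    (hf : f.IsSymmetric) (hdeg : f.totalDegree ≤ (m + 1) * m) (hv : VanishesOnFew m f) :
    ∃ c : F, f = c • discrSum F n (m + 1) := by
  induction n generalizing m with
  | zero =>
    refine ⟨0, ?_⟩
    rw [zero_smul]
    exact MvPolynomial.funext fun a => by simpa using hv a (by simp [Set.range_eq_empty])
  | succ n ih =>
    rcases m with _ | m
    · have hd : (discrSum F (n + 1) 1).totalDegree = 0 := by
        simpa using (discrSum_isHomogeneous F (n + 1) 1).totalDegree_le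
      have h0 := discrSum_ne_zero F (n + 1) 1 (by omega)
      rw [totalDegree_eq_zero_iff_eq_C] at hd
      have hfC := totalDegree_eq_zero_iff_eq_C.1 (Nat.le_zero.1 (by simpa using hdeg))
      have hd0 : coeff 0 (discrSum F (n + 1) 1) ≠ 0 := by
        intro h
        rw [h, C_0] at hd
        exact h0 hd
      refine ⟨coeff 0 f / coeff 0 (discrSum F (n + 1) 1), ?_⟩
      rw [zero_add, hd, smul_eq_C_mul, ← C_mul, coeff_C, if_pos rfl, div_mul_cancel₀ _ hd0]
      exact hfC
    have hlow : ∀ g : MvPolynomial (Fin (n + 1)) F, g.IsSymmetric →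
        g.totalDegree ≤ (m + 1 + 1) * (m + 1) → VanishesOnFew (m + 1) g → ∀ j, 2 * (m + 1) < j →
        (finSuccEquiv F n g).coeff j = 0 := by
      intro g hg hgd hgv j hj
      by_contra hne
      have hd := totalDegree_coeff_finSuccEquiv_add_le g j hne
      have hd' : ((finSuccEquiv F n g).coeff j).totalDegree < (m + 1) * m := by nlinarith
      obtain ⟨c, hc⟩ := ih m _ (hg.coeff_finSuccEquiv j) hd'.le (hgv.coeff_finSuccEquiv j)
      rw [hc] at hd' hne
      exact hne (smul_discrSum_eq_zero hd')
    have htop : ∃ c : F, (finSuccEquiv F n f).coeff (2 * (m + 1)) = c • discrSum F n (m + 1) := by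
      by_cases h0 : (finSuccEquiv F n f).coeff (2 * (m + 1)) = 0
      · exact ⟨0, by rw [h0, zero_smul]⟩
      have hd := totalDegree_coeff_finSuccEquiv_add_le f _ h0
      exact ih m _ (hf.coeff_finSuccEquiv _) (by nlinarith) (hv.coeff_finSuccEquiv _)
    obtain ⟨c, hc⟩ := htop
    refine ⟨c, sub_eq_zero.1 ?_⟩
    set g := f - c • discrSum F (n + 1) (m + 1 + 1) with hg
    have hgs : g.IsSymmetric := hf.sub ((discrSum_isSymmetric F _ _).smul c)
    have hgd : g.totalDegree ≤ (m + 1 + 1) * (m + 1) :=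
      (totalDegree_sub _ _).trans (max_le hdeg ((totalDegree_smul_le _ _).trans
        (discrSum_isHomogeneous F _ _).totalDegree_le))
    have hgv : VanishesOnFew (m + 1) g := by
      intro a ha
      rw [hg, map_sub, smul_eval, hv a ha, vanishesOnFew_discrSum _ _ a ha, mul_zero, sub_zero]
    have hgc : ∀ j, 2 * (m + 1) ≤ j → (finSuccEquiv F n g).coeff j = 0 := by
      intro j hj
      rcases hj.lt_or_eq with hj | rfl
      · exact hlow g hgs hgd hgv j hj
      · rw [hg, map_sub, map_smul, Polynomial.coeff_sub, Polynomial.coeff_smul, hc,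
          coeff_finSuccEquiv_discrSum F n (m + 1) (by omega), sub_self]
    have hg0 : ∀ j, j ≠ 0 → (finSuccEquiv F n g).coeff j = 0 := by
      intro j hj
      by_contra hne
      have hd := totalDegree_coeff_finSuccEquiv_add_le g j hne
      have hd' : ((finSuccEquiv F n g).coeff j).totalDegree < (m + 1 + 1) * (m + 1) := by omega
      obtain ⟨e, he⟩ := ih (m + 1) _ (hgs.coeff_finSuccEquiv j) hd'.le
        (hgv.coeff_finSuccEquiv_of_coeff_eq_zero hgs hgc j)
      rw [he] at hd' hne
      exact hne (smul_discrSum_eq_zero hd')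
    have hgC := totalDegree_eq_zero_iff_eq_C.1 (hgs.totalDegree_eq_zero hg0)
    have hz := hgv 0 (by
      refine (Set.ncard_le_ncard (t := {0}) ?_).trans (by simp)
      rintro _ ⟨i, rfl⟩
      rfl)
    rw [hgC, eval_C] at hz
    rw [hgC, hz, C_0]

end Main

/-- Every non-zero symmetric polynomial vanishing on the set `D_k` of points with at most
`n−k−1` distinct coordinates has degree at least `(n−k)(n−k−1)`; and the symmetric
polynomials in `I(D_k)` homogeneous of degree `(n−k)(n−k−1)` form the one-dimensional
space spanned by `Δ_{n,k}`. -/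
theorem stmt9 (F : Type*) [Field F] [CharZero F] (n k : ℕ) (hn : 1 ≤ n) (hk : k ≤ n - 2) :
    (∀ f : MvPolynomial (Fin n) F, f.IsSymmetric → f ≠ 0 →
      (∀ a : Fin n → F, (Set.range a).ncard ≤ n - k - 1 → MvPolynomial.eval a f = 0) →
      (n - k) * (n - k - 1) ≤ f.totalDegree) ∧
    (DeltaPoly F n k ≠ 0 ∧ (DeltaPoly F n k).IsSymmetric ∧
      (DeltaPoly F n k).IsHomogeneous ((n - k) * (n - k - 1)) ∧
      (∀ a : Fin n → F, (Set.range a).ncard ≤ n - k - 1 →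
        MvPolynomial.eval a (DeltaPoly F n k) = 0)) ∧
    (∀ f : MvPolynomial (Fin n) F, f.IsSymmetric →
      f.IsHomogeneous ((n - k) * (n - k - 1)) →
      (∀ a : Fin n → F, (Set.range a).ncard ≤ n - k - 1 → MvPolynomial.eval a f = 0) →
      ∃ c : F, f = c • DeltaPoly F n k) := by
  obtain ⟨m, hm⟩ : ∃ m, n - k = m + 1 := ⟨n - k - 1, by omega⟩
  have hD : DeltaPoly F n k = discrSum F n (m + 1) := by
    rw [← hm]
    rfl
  have h0 := discrSum_ne_zero F n (m + 1) (by omega)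
  have hh := discrSum_isHomogeneous F n (m + 1)
  rw [hD, hm, Nat.add_sub_cancel]
  rw [Nat.add_sub_cancel] at hh
  refine ⟨fun f hf hne hv => ?_, ⟨h0, discrSum_isSymmetric F n _, hh,
    vanishesOnFew_discrSum n m⟩, fun f hf hfh hv =>
    exists_eq_smul_discrSum n m f hf hfh.totalDegree_le hv⟩
  by_contra! hlt
  obtain ⟨c, rfl⟩ := exists_eq_smul_discrSum n m f hf hlt.le hv
  exact hne (smul_discrSum_eq_zero hlt)
end

section
/- Over an algebraically closed field F of characteristic zero, any conjugation-invariant polynomial function on n×n matrices of degree less than (n−k)(n−k−1) that vanishes on every matrix with at most n−k−1 distinct eigenvalues is zero; and every conjugation-invariant homogeneous polynomial of degree (n−k)(n−k−1) vanishing on that set is a scalar multiple of sDisc_k. -/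
section SymmetricVanishing

open MvPolynomial

variable {F α : Type*} [Field F]

section Divisibility

lemma X_sub_X_dvd_iff_rename_eq_zero [DecidableEq α] {i j : α} {q : MvPolynomial α F} :
    (X i - X j) ∣ q ↔ rename (Function.update id i j) q = 0 := by
  constructor
  · rintro ⟨h, rfl⟩
    rcases eq_or_ne j i with rfl | hij <;> simp [*]
  · intro h
    rw [← Ideal.mem_span_singleton, ← Ideal.Quotient.eq_zero_iff_mem]
    have key : (Ideal.Quotient.mkₐ F (Ideal.span {(X i - X j : MvPolynomial α F)})).comp
        (rename (Function.update id i j)) = Ideal.Quotient.mkₐ F _ := by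
      ext a
      by_cases ha : a = i
      · subst ha
        simp only [AlgHom.comp_apply, rename_X, Function.update_self, Ideal.Quotient.mkₐ_eq_mk]
        rw [eq_comm, Ideal.Quotient.eq]
        exact Ideal.mem_span_singleton_self _
      · simp [ha]
    have := DFunLike.congr_fun key q
    simpa [h] using this.symm

lemma rename_X_sub_X [DecidableEq α] (i j : α) :
    rename (Function.update id i j) (X i - X j : MvPolynomial α F) = 0 :=
  X_sub_X_dvd_iff_rename_eq_zero.1 dvd_rfl

lemma X_sub_X_ne_zero {i j : α} (hij : i ≠ j) : (X i - X j : MvPolynomial α F) ≠ 0 :=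
  sub_ne_zero.2 fun h => hij (X_injective h)

lemma prime_X_sub_X [DecidableEq α] {i j : α} (hij : i ≠ j) :
    Prime (X i - X j : MvPolynomial α F) := by
  refine ⟨X_sub_X_ne_zero hij, fun hu => ?_, fun a b hab => ?_⟩
  · have := hu.map (rename (Function.update id i j) : MvPolynomial α F →ₐ[F] _)
    rw [rename_X_sub_X] at this
    exact not_isUnit_zero this
  · simpa only [X_sub_X_dvd_iff_rename_eq_zero, map_mul, mul_eq_zero] using hab

lemma X_sub_X_sq_dvd [DecidableEq α] {i j : α} (hij : i ≠ j) {q : MvPolynomial α F}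
    (h0 : rename (Function.update id i j) q = 0)
    (h1 : rename (Function.update id i j) (pderiv i q) = 0) :
    (X i - X j) ^ 2 ∣ q := by
  obtain ⟨h, rfl⟩ := X_sub_X_dvd_iff_rename_eq_zero.2 h0
  rw [pow_two]
  refine mul_dvd_mul_left _ (X_sub_X_dvd_iff_rename_eq_zero.2 ?_)
  simpa [pderiv_mul, pderiv_X_of_ne hij.symm, hij, hij.symm] using h1

lemma X_sub_X_cube_dvd [DecidableEq α] [CharZero F] {i j : α} (hij : i ≠ j) {q : MvPolynomial α F}
    (h0 : (X i - X j) ^ 2 ∣ q)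
    (h1 : rename (Function.update id i j) (pderiv i (pderiv j q)) = 0) :
    (X i - X j) ^ 3 ∣ q := by
  obtain ⟨h, rfl⟩ := h0
  rw [pow_succ]
  refine mul_dvd_mul_left _ (X_sub_X_dvd_iff_rename_eq_zero.2 ?_)
  simpa [pow_two, pderiv_mul, pderiv_X_of_ne hij.symm, pderiv_X_of_ne hij, hij, hij.symm,
    neg_add_eq_zero, ← two_mul, ← sub_eq_add_neg, sub_eq_zero, neg_eq_zero, map_ofNat] using h1

end Divisibility

section Products

variable [LinearOrder α]

lemma isRelPrime_X_sub_X {p p' : α × α} (hp : p.1 < p.2) (hp' : p'.1 < p'.2) (h : p ≠ p') :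
    IsRelPrime (X p.1 - X p.2 : MvPolynomial α F) (X p'.1 - X p'.2) := by
  rw [(prime_X_sub_X hp.ne).irreducible.isRelPrime_iff_not_dvd, X_sub_X_dvd_iff_rename_eq_zero,
    map_sub, rename_X, rename_X, sub_eq_zero, (X_injective).eq_iff]
  obtain ⟨a, b⟩ := p
  obtain ⟨c, d⟩ := p'
  simp only [Function.update_apply, id, ne_eq, Prod.mk.injEq] at *
  grind

lemma prod_X_sub_X_pow_dvd {q : MvPolynomial α F} {P : Finset (α × α)}
    (hP : ∀ p ∈ P, p.1 < p.2) {e : α × α → ℕ}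
    (h : ∀ p ∈ P, (X p.1 - X p.2) ^ e p ∣ q) : ∏ p ∈ P, (X p.1 - X p.2) ^ e p ∣ q :=
  Finset.prod_dvd_of_isRelPrime
    (fun p hp p' hp' hpp' => (isRelPrime_X_sub_X (hP p hp) (hP p' hp') hpp').pow) h

lemma prod_X_sub_X_pow_ne_zero {P : Finset (α × α)} (hP : ∀ p ∈ P, p.1 < p.2) (e : α × α → ℕ) :
    ∏ p ∈ P, (X p.1 - X p.2 : MvPolynomial α F) ^ e p ≠ 0 :=
  Finset.prod_ne_zero_iff.2 fun p hp => pow_ne_zero _ (X_sub_X_ne_zero (hP p hp).ne)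

lemma totalDegree_prod_X_sub_X_pow {P : Finset (α × α)} (hP : ∀ p ∈ P, p.1 < p.2)
    (e : α × α → ℕ) :
    (∏ p ∈ P, (X p.1 - X p.2 : MvPolynomial α F) ^ e p).totalDegree = ∑ p ∈ P, e p := by
  have hhom : (∏ p ∈ P, (X p.1 - X p.2 : MvPolynomial α F) ^ e p).IsHomogeneous
      (∑ p ∈ P, e p) := by
    refine IsHomogeneous.prod _ _ _ fun p _ => ?_
    simpa using ((isHomogeneous_X F p.1).sub (isHomogeneous_X F p.2)).pow (e p)
  exact hhom.totalDegree (prod_X_sub_X_pow_ne_zero hP e)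

lemma sum_le_totalDegree {q : MvPolynomial α F} (hq : q ≠ 0) {P : Finset (α × α)}
    (hP : ∀ p ∈ P, p.1 < p.2) {e : α × α → ℕ}
    (h : ∀ p ∈ P, (X p.1 - X p.2) ^ e p ∣ q) : ∑ p ∈ P, e p ≤ q.totalDegree := by
  rw [← totalDegree_prod_X_sub_X_pow (F := F) hP e]
  exact totalDegree_le_of_dvd_of_isDomain (prod_X_sub_X_pow_dvd hP h) hq

lemma two_mul_card_filter_lt (T : Finset α) :
    2 * ((T ×ˢ T).filter fun p => p.1 < p.2).card = T.card * (T.card - 1) := by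
  have h1 : ((T ×ˢ T).filter fun p => p.2 < p.1).card =
      ((T ×ˢ T).filter fun p => p.1 < p.2).card :=
    Finset.card_bij' (fun p _ => p.swap) (fun p _ => p.swap) (by simp; tauto) (by simp; tauto)
      (by simp) (by simp)
  have h2 : T.offDiag = ((T ×ˢ T).filter fun p => p.1 < p.2) ∪
      ((T ×ˢ T).filter fun p => p.2 < p.1) := by
    ext p
    simp only [Finset.mem_offDiag, Finset.mem_union, Finset.mem_filter, Finset.mem_product]
    grind
  rw [Nat.mul_sub_one, ← Finset.offDiag_card, h2, Finset.card_union_of_disjoint, h1, two_mul]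
  exact Finset.disjoint_filter.2 fun p _ => lt_asymm

end Products

section ChainRule

lemma pderiv_rename_eq_sum [Fintype α] [DecidableEq α] (σ : α → α) (i : α)
    (p : MvPolynomial α F) :
    pderiv i (rename σ p) = ∑ l with σ l = i, rename σ (pderiv l p) := by
  induction p using MvPolynomial.induction_on with
  | C a => simp
  | add p q hp hq => simp [hp, hq, Finset.sum_add_distrib]
  | mul_X p a hp =>
    simp only [map_mul, rename_X, pderiv_mul, hp, map_add, Finset.sum_add_distrib, pderiv_X,
      Finset.sum_mul, Pi.single_apply]
    congr 1
    rw [← Finset.mul_sum, Finset.sum_filter, Finset.sum_eq_single a]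
    · simp only [if_true, map_one]
    · intro b _ hb
      simp [hb.symm]
    · simp

lemma rename_pderiv_perm {p : MvPolynomial α F} (hp : p.IsSymmetric) (e : Equiv.Perm α) (l : α) :
    pderiv (e l) p = rename e (pderiv l p) := by
  conv_lhs => rw [← hp e]
  exact pderiv_rename e.injective _ _

lemma comp_swap_eq [DecidableEq α] {τ : α → α} {l k : α} (h : τ l = τ k) :
    τ ∘ Equiv.swap l k = τ := by
  funext x
  simp only [Function.comp_apply, Equiv.swap_apply_def]
  grind

lemma rename_pderiv_eq [DecidableEq α] {p : MvPolynomial α F} (hp : p.IsSymmetric)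
    {τ : α → α} {l k : α} (h : τ l = τ k) : rename τ (pderiv l p) = rename τ (pderiv k p) := by
  have := rename_pderiv_perm hp (Equiv.swap l k) l
  rw [Equiv.swap_apply_left] at this
  rw [this, rename_rename, comp_swap_eq h]

lemma rename_pderiv_pderiv_eq [DecidableEq α] {p : MvPolynomial α F} (hp : p.IsSymmetric)
    {τ : α → α} {l k m : α} (h : τ l = τ k) (hl : m ≠ l) (hk : m ≠ k) :
    rename τ (pderiv l (pderiv m p)) = rename τ (pderiv k (pderiv m p)) := by
  have h1 := rename_pderiv_perm hp (Equiv.swap l k) m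
  rw [Equiv.swap_apply_of_ne_of_ne hl hk] at h1
  have h2 := pderiv_rename (Equiv.swap l k).injective l (pderiv m p)
  rw [Equiv.swap_apply_left, ← h1] at h2
  rw [h2, rename_rename, comp_swap_eq h]

lemma pderiv_pderiv_comm (i j : α) (p : MvPolynomial α F) :
    pderiv i (pderiv j p) = pderiv j (pderiv i p) := by
  classical
  have h : ⁅pderiv (R := F) i, pderiv (R := F) j⁆ = 0 := by
    ext k
    simp only [Derivation.commutator_apply, pderiv_X, Pi.single_apply]
    split_ifs <;> simp
  have := DFunLike.congr_fun h p
  rwa [Derivation.commutator_apply, Derivation.zero_apply, sub_eq_zero] at this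

end ChainRule

section Strata

variable [CharZero F] [Fintype α] {p : MvPolynomial α F} {r : ℕ}

lemma card_image_update_comp_le [DecidableEq α] {σ : α → α} {i j : α}
    (hσ : (Finset.univ.image σ).card = r + 1)
    (hi : i ∈ Finset.univ.image σ) (hj : j ∈ Finset.univ.image σ) (hij : i ≠ j) :
    (Finset.univ.image (Function.update id i j ∘ σ)).card ≤ r := by
  have : Finset.univ.image (Function.update id i j ∘ σ) ⊆ (Finset.univ.image σ).erase i := by
    intro x hx
    simp only [Finset.mem_image, Finset.mem_univ, true_and, Finset.mem_erase, Function.comp_apply,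
      Function.update_apply, id] at *
    grind
  refine (Finset.card_le_card this).trans ?_
  rw [Finset.card_erase_of_mem hi, hσ, Nat.add_sub_cancel]

lemma X_sub_X_sq_dvd_rename [DecidableEq α] (hp : p.IsSymmetric)
    (hV : ∀ σ : α → α, (Finset.univ.image σ).card ≤ r → rename σ p = 0) {σ : α → α} {i j : α}
    (hσ : (Finset.univ.image σ).card = r + 1)
    (hi : i ∈ Finset.univ.image σ) (hj : j ∈ Finset.univ.image σ) (hij : i ≠ j) :
    (X i - X j) ^ 2 ∣ rename σ p := by
  have hτ := hV _ (card_image_update_comp_le hσ hi hj hij)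
  refine X_sub_X_sq_dvd hij (by rw [rename_rename, hτ]) ?_
  have hzero : ∀ l, (Function.update id i j ∘ σ) l = j →
      rename (Function.update id i j ∘ σ) (pderiv l p) = 0 := by
    intro l hl
    have h := pderiv_rename_eq_sum (Function.update id i j ∘ σ) j p
    rw [hτ, map_zero, Finset.sum_congr rfl fun k hk => rename_pderiv_eq hp
      ((Finset.mem_filter.1 hk).2.trans hl.symm), Finset.sum_const, eq_comm,
      smul_eq_zero] at h
    refine h.resolve_left (Finset.card_ne_zero_of_mem (a := l) ?_)
    simpa using hl
  rw [pderiv_rename_eq_sum, map_sum]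
  refine Finset.sum_eq_zero fun l hl => ?_
  rw [rename_rename]
  refine hzero l ?_
  simp [(Finset.mem_filter.1 hl).2]

lemma rename_eq_zero_of_totalDegree_lt [LinearOrder α] (hp : p.IsSymmetric)
    (hV : ∀ σ : α → α, (Finset.univ.image σ).card ≤ r → rename σ p = 0)
    (hdeg : p.totalDegree < (r + 1) * r) {σ : α → α}
    (hσ : (Finset.univ.image σ).card ≤ r + 1) : rename σ p = 0 := by
  rcases Nat.le_succ_iff.1 hσ with hσ | hσ
  · exact hV σ hσ
  by_contra hne
  have h := sum_le_totalDegree hne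
    (P := (Finset.univ.image σ ×ˢ Finset.univ.image σ).filter fun p => p.1 < p.2)
    (by simp) (e := fun _ => 2) (fun x hx => by
      rw [Finset.mem_filter, Finset.mem_product] at hx
      exact X_sub_X_sq_dvd_rename hp hV hσ hx.1.1 hx.1.2 hx.2.ne)
  rw [Finset.sum_const, smul_eq_mul, mul_comm, two_mul_card_filter_lt, hσ,
    Nat.succ_sub_one] at h
  exact absurd (h.trans (totalDegree_rename_le σ p)) hdeg.not_ge

lemma eq_zero_of_totalDegree_lt [LinearOrder α] (hp : p.IsSymmetric)
    (hV : ∀ σ : α → α, (Finset.univ.image σ).card ≤ r → rename σ p = 0)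
    (hdeg : p.totalDegree < (r + 1) * r) : p = 0 := by
  have key : ∀ d, ∀ σ : α → α, (Finset.univ.image σ).card ≤ r + d → rename σ p = 0 := by
    intro d
    induction d with
    | zero => exact hV
    | succ d ih =>
      intro σ hσ
      refine rename_eq_zero_of_totalDegree_lt hp ih (hdeg.trans_le ?_) hσ
      gcongr <;> omega
  have := key (Fintype.card α) id ((Finset.card_le_univ _).trans (Nat.le_add_left _ _))
  rwa [rename_id, AlgHom.id_apply] at this

omit [CharZero F] in
lemma rename_pderiv_pderiv_rename [DecidableEq α] (hp : p.IsSymmetric) {σ : α → α} {i j l m : α}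
    (hij : i ≠ j) (hl : σ l = i) (hm : σ m = j) :
    rename (Function.update id i j) (pderiv i (pderiv j (rename σ p))) =
      ((Finset.univ.filter fun k => σ k = j).card * (Finset.univ.filter fun k => σ k = i).card) •
        rename (Function.update id i j ∘ σ) (pderiv l (pderiv m p)) := by
  rw [pderiv_rename_eq_sum, map_sum, map_sum, mul_smul, ← Finset.sum_const]
  refine Finset.sum_congr rfl fun m' hm' => ?_
  replace hm' := (Finset.mem_filter.1 hm').2
  rw [pderiv_rename_eq_sum, map_sum, ← Finset.sum_const]
  refine Finset.sum_congr rfl fun l' hl' => ?_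
  replace hl' := (Finset.mem_filter.1 hl').2
  have hne : ∀ {x y}, σ x = i → σ y = j → y ≠ x := by
    rintro x y hx hy rfl
    exact hij (hx.symm.trans hy)
  rw [rename_rename, rename_pderiv_pderiv_eq hp (τ := Function.update id i j ∘ σ) (l := l')
    (k := l) (by simp [hl, hl']) (hne hl' hm') (hne hl hm')]
  rw [pderiv_pderiv_comm, pderiv_pderiv_comm l m, rename_pderiv_pderiv_eq hp (by simp [hm, hm'])
    (hne hl hm').symm (hne hl hm).symm]

lemma rename_eq_zero_of_merge_eq [LinearOrder α] (hp : p.IsSymmetric)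
    (hV : ∀ σ : α → α, (Finset.univ.image σ).card ≤ r → rename σ p = 0)
    (hdeg : p.totalDegree ≤ (r + 1) * r) {σ σ' : α → α}
    (hσ' : (Finset.univ.image σ').card = r + 1) {i j l m : α} (hij : i ≠ j)
    (hl : σ l = i) (hm : σ m = j) (hl' : σ' l = i) (hm' : σ' m = j)
    (hmerge : Function.update id i j ∘ σ = Function.update id i j ∘ σ')
    (h0 : rename σ p = 0) : rename σ' p = 0 := by
  wlog hlt : i < j generalizing i j l m
  · refine this hij.symm hm hl hm' hl' ?_ (hij.lt_or_gt.resolve_left hlt)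
    funext x
    have := congr_fun hmerge x
    simp only [Function.comp_apply, Function.update_apply, id] at this ⊢
    grind
  by_contra hne
  have h1 := rename_pderiv_pderiv_rename hp hij hl hm
  rw [h0, map_zero, map_zero, map_zero, eq_comm, smul_eq_zero] at h1
  replace h1 := h1.resolve_left (mul_ne_zero
    (Finset.card_ne_zero_of_mem (a := m) (by simpa using hm))
    (Finset.card_ne_zero_of_mem (a := l) (by simpa using hl)))
  have h2 := rename_pderiv_pderiv_rename hp hij hl' hm'
  rw [← hmerge, h1, smul_zero] at h2
  have hmem : ∀ {x y}, σ' x = y → y ∈ Finset.univ.image σ' := by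
    rintro x _ rfl
    exact Finset.mem_image_of_mem _ (Finset.mem_univ _)
  have hsq : ∀ a ∈ Finset.univ.image σ', ∀ b ∈ Finset.univ.image σ', a ≠ b →
      (X a - X b) ^ 2 ∣ rename σ' p := fun a ha b hb hab =>
    X_sub_X_sq_dvd_rename hp hV hσ' ha hb hab
  set P := (Finset.univ.image σ' ×ˢ Finset.univ.image σ').filter fun p => p.1 < p.2 with hP
  have hijP : (i, j) ∈ P := by
    rw [hP, Finset.mem_filter, Finset.mem_product]
    exact ⟨⟨hmem hl', hmem hm'⟩, hlt⟩
  have h := sum_le_totalDegree hne (P := P) (by simp [hP])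
    (e := fun x => 2 + if x = (i, j) then 1 else 0) (fun x hx => by
      split_ifs with hx'
      · subst hx'
        exact X_sub_X_cube_dvd hij (hsq i (hmem hl') j (hmem hm') hij) h2
      · rw [hP, Finset.mem_filter, Finset.mem_product] at hx
        exact hsq _ hx.1.1 _ hx.1.2 hx.2.ne)
  rw [Finset.sum_add_distrib, Finset.sum_const, smul_eq_mul, mul_comm, two_mul_card_filter_lt, hσ',
    Nat.add_sub_cancel, Finset.sum_ite_eq' P, if_pos hijP] at h
  have := h.trans ((totalDegree_rename_le σ' p).trans hdeg)
  omega

lemma rename_eq_zero_of_image_eq [LinearOrder α] (hp : p.IsSymmetric)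
    (hV : ∀ σ : α → α, (Finset.univ.image σ).card ≤ r → rename σ p = 0)
    (hdeg : p.totalDegree ≤ (r + 1) * r) {σ' : α → α}
    (hσ' : (Finset.univ.image σ').card = r + 1) :
    ∀ (d : ℕ) (σ : α → α), (Finset.univ.filter fun l => σ l ≠ σ' l).card ≤ d →
      Finset.univ.image σ = Finset.univ.image σ' → rename σ p = 0 → rename σ' p = 0 := by
  intro d
  induction d with
  | zero =>
    intro σ hd _ h0
    have : σ = σ' := by
      funext l
      by_contra hl
      exact Finset.card_ne_zero_of_mem (Finset.mem_filter.2 ⟨Finset.mem_univ l, hl⟩)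
        (Nat.le_zero.1 hd)
    rwa [← this]
  | succ d ih =>
    intro σ hd him h0
    by_cases heq : σ = σ'
    · rwa [← heq]
    obtain ⟨l, hl⟩ := Function.ne_iff.1 heq
    have hsurj : ∀ x, ∃ y, σ' y = σ x := fun x => by
      have := Finset.mem_image_of_mem σ (Finset.mem_univ x)
      rw [him] at this
      simpa using this
    have hsurj' : ∀ x, ∃ y, σ y = σ' x := fun x => by
      have := Finset.mem_image_of_mem σ' (Finset.mem_univ x)
      rw [← him] at this
      simpa using this
    by_cases hfib : ∃ k, k ≠ l ∧ σ k = σ l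
    · obtain ⟨k, hkl, hk⟩ := hfib
      obtain ⟨m, hm⟩ := hsurj' l
      have hml : m ≠ l := by
        rintro rfl
        exact hl hm
      have him1 : Finset.univ.image (Function.update σ l (σ' l)) = Finset.univ.image σ' := by
        rw [← him]
        ext x
        simp only [Finset.mem_image, Finset.mem_univ, true_and, Function.update_apply]
        grind
      refine ih (Function.update σ l (σ' l)) ?_ him1 ?_
      · refine Nat.lt_succ_iff.1 (lt_of_lt_of_le (Finset.card_lt_card ?_) hd)
        rw [Finset.ssubset_iff_of_subset]
        · exact ⟨l, by simpa using hl, by simp⟩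
        · intro x
          simp only [Finset.mem_filter, Finset.mem_univ, true_and, Function.update_apply]
          grind
      · refine rename_eq_zero_of_merge_eq hp hV hdeg (him1 ▸ hσ') hl hk hm
          (by simp [hkl, hk]) (by simp [hml, hm]) ?_ h0
        funext x
        simp only [Function.comp_apply, Function.update_apply, id]
        grind
    · obtain ⟨k, hk⟩ := hsurj l
      have hkl : k ≠ l := by
        rintro rfl
        exact hl hk.symm
      refine ih (σ ∘ Equiv.swap l k) ?_ ?_ ?_
      · refine Nat.lt_succ_iff.1 (lt_of_lt_of_le (Finset.card_lt_card ?_) hd)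
        rw [Finset.ssubset_iff_of_subset]
        · refine ⟨k, ?_, by simp [hk]⟩
          simp only [Finset.mem_filter, Finset.mem_univ, true_and, hk]
          exact fun h => hfib ⟨k, hkl, h⟩
        · intro x
          simp only [Finset.mem_filter, Finset.mem_univ, true_and, Function.comp_apply,
            Equiv.swap_apply_def]
          grind
      · rw [← Finset.image_image, Finset.image_univ_of_surjective (Equiv.swap l k).surjective, him]
      · rw [← rename_rename, hp, h0]

lemma eq_zero_of_rename_eq_zero [LinearOrder α] (hp : p.IsSymmetric)
    (hV : ∀ σ : α → α, (Finset.univ.image σ).card ≤ r → rename σ p = 0)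
    (hdeg : p.totalDegree ≤ (r + 1) * r) {σ : α → α}
    (hσ : (Finset.univ.image σ).card = r + 1) (h0 : rename σ p = 0) : p = 0 := by
  refine eq_zero_of_totalDegree_lt (r := r + 1) hp (fun σ' hσ' => ?_)
    (hdeg.trans_lt (by nlinarith))
  rcases Nat.le_succ_iff.1 hσ' with hσ' | hσ'
  · exact hV σ' hσ'
  let e : Equiv.Perm α := (Finset.equivOfCardEq (hσ.trans hσ'.symm)).extendSubtype
  have he : ∀ x ∈ Finset.univ.image σ, e x ∈ Finset.univ.image σ' := fun x hx =>
    Equiv.extendSubtype_mem _ x hx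
  refine rename_eq_zero_of_image_eq hp hV hdeg hσ' _ (e ∘ σ) le_rfl ?_ ?_
  · refine Finset.eq_of_subset_of_card_le ?_ ?_
    · rw [← Finset.image_image]
      exact Finset.image_subset_iff.2 he
    · rw [← Finset.image_image, Finset.card_image_of_injective _ e.injective, hσ, hσ']
  · rw [← rename_rename, h0, map_zero]

lemma exists_C_mul_prod_eq [LinearOrder α] (hp : p.IsSymmetric)
    (hV : ∀ σ : α → α, (Finset.univ.image σ).card ≤ r → rename σ p = 0)
    (hdeg : p.totalDegree ≤ (r + 1) * r) {σ : α → α}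
    (hσ : (Finset.univ.image σ).card = r + 1) :
    ∃ c : F, rename σ p = C c *
      ∏ x ∈ (Finset.univ.image σ ×ˢ Finset.univ.image σ).filter (fun p => p.1 < p.2),
        (X x.1 - X x.2) ^ 2 := by
  set P := (Finset.univ.image σ ×ˢ Finset.univ.image σ).filter fun p => p.1 < p.2 with hP
  have hlt : ∀ p ∈ P, p.1 < p.2 := by simp [hP]
  rcases eq_or_ne (rename σ p) 0 with h0 | h0
  · exact ⟨0, by simp [h0]⟩
  obtain ⟨h, hh⟩ : ∏ x ∈ P, (X x.1 - X x.2) ^ 2 ∣ rename σ p :=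
    prod_X_sub_X_pow_dvd hlt (e := fun _ => 2) fun x hx => by
      rw [hP, Finset.mem_filter, Finset.mem_product] at hx
      exact X_sub_X_sq_dvd_rename hp hV hσ hx.1.1 hx.1.2 hx.2.ne
  have hd := (totalDegree_rename_le σ p).trans hdeg
  rw [hh, totalDegree_mul_of_isDomain (prod_X_sub_X_pow_ne_zero hlt fun _ => 2)
    (right_ne_zero_of_mul (hh ▸ h0)), totalDegree_prod_X_sub_X_pow hlt fun _ => 2,
    Finset.sum_const, smul_eq_mul, mul_comm, two_mul_card_filter_lt, hσ,
    Nat.add_sub_cancel] at hd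
  obtain ⟨c, rfl⟩ : ∃ c, h = C c := ⟨_, totalDegree_eq_zero_iff_eq_C.1 (by omega)⟩
  exact ⟨c, by rw [hh, mul_comm]⟩

lemma exists_eq_smul [LinearOrder α] {q : MvPolynomial α F} (hp : p.IsSymmetric)
    (hq : q.IsSymmetric)
    (hVp : ∀ σ : α → α, (Finset.univ.image σ).card ≤ r → rename σ p = 0)
    (hVq : ∀ σ : α → α, (Finset.univ.image σ).card ≤ r → rename σ q = 0)
    (hdp : p.totalDegree ≤ (r + 1) * r) (hdq : q.totalDegree ≤ (r + 1) * r)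
    (hr : r + 1 ≤ Fintype.card α) (hq0 : q ≠ 0) : ∃ c : F, p = c • q := by
  obtain ⟨σ, hσ⟩ : ∃ σ : α → α, (Finset.univ.image σ).card = r + 1 := by
    obtain ⟨T, -, hT⟩ := Finset.exists_subset_card_eq (s := (Finset.univ : Finset α)) hr
    obtain ⟨t, ht⟩ : T.Nonempty := Finset.card_pos.1 (by omega)
    refine ⟨fun x => if x ∈ T then x else t, ?_⟩
    rw [← hT]
    congr 1
    ext x
    simp only [Finset.mem_image, Finset.mem_univ, true_and]
    grind
  obtain ⟨a, ha⟩ := exists_C_mul_prod_eq hp hVp hdp hσ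
  obtain ⟨b, hb⟩ := exists_C_mul_prod_eq hq hVq hdq hσ
  have hb0 : b ≠ 0 := by
    rintro rfl
    exact hq0 (eq_zero_of_rename_eq_zero hq hVq hdq hσ (by simpa using hb))
  refine ⟨a / b, sub_eq_zero.1 ?_⟩
  refine eq_zero_of_rename_eq_zero (r := r) (σ := σ) ?_ ?_ ?_ hσ ?_
  · intro e
    rw [map_sub, map_smul, hp, hq]
  · intro τ hτ
    rw [map_sub, map_smul, hVp τ hτ, hVq τ hτ, smul_zero, sub_zero]
  · exact (totalDegree_sub _ _).trans (max_le hdp ((totalDegree_smul_le _ _).trans hdq))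
  · rw [map_sub, map_smul, ha, hb, smul_eq_C_mul, ← mul_assoc, ← C_mul, div_mul_cancel₀ _ hb0,
      sub_self]

end Strata

section Matrices

open Matrix

variable [Fintype α] [DecidableEq α]

lemma exists_eq_conj_diagonal_of_separable [IsAlgClosed F] {A : Matrix α α F}
    (hA : A.charpoly.Separable) : ∃ (g : GL α F) (lam : α → F),
      A = (g : Matrix α α F) * diagonal lam * ((g⁻¹ : GL α F) : Matrix α α F) := by
  have hcard : Fintype.card (A.charpoly.rootSet F) = Fintype.card α := by
    rw [Polynomial.card_rootSet_eq_natDegree hA (IsAlgClosed.splits _), charpoly_natDegree_eq_dim]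
  let e := Fintype.equivOfCardEq hcard.symm
  have hroot : ∀ i, ∃ v, Module.End.HasEigenvector (toLin' A) (e i : F) v := fun i => by
    refine Module.End.HasEigenvalue.exists_hasEigenvector ?_
    rw [Module.End.hasEigenvalue_iff_isRoot_charpoly, charpoly_toLin', Polynomial.IsRoot,
      ← Polynomial.coe_aeval_eq_eval]
    exact (Polynomial.mem_rootSet.1 (e i).2).2
  choose v hv using hroot
  have hind := Module.End.eigenvectors_linearIndependent' (toLin' A) (fun i => (e i : F))
    (Subtype.val_injective.comp e.injective) v hv
  let M : Matrix α α F := (Matrix.of v)ᵀ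
  have hM : IsUnit M := linearIndependent_cols_iff_isUnit.1 hind
  refine ⟨hM.unit, fun i => e i, ?_⟩
  rw [← Units.mul_inv_eq_iff_eq_mul]
  ext i j
  have := congr_fun (hv j).apply_eq_smul i
  rw [inv_inv, IsUnit.unit_spec, mul_diagonal]
  simpa [M, mul_apply, mulVec, dotProduct, mul_comm] using this

lemma exists_charpoly_eq_prod [IsAlgClosed F] (A : Matrix α α F) :
    ∃ lam : α → F, A.charpoly = ∏ i, (Polynomial.X - Polynomial.C (lam i)) := by
  have hs := IsAlgClosed.splits A.charpoly
  have hcard : Fintype.card α = A.charpoly.roots.toList.length := by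
    rw [Multiset.length_toList, ← hs.natDegree_eq_card_roots, charpoly_natDegree_eq_dim]
  refine ⟨fun i => A.charpoly.roots.toList.get (Fin.cast hcard (Fintype.equivFin α i)), ?_⟩
  refine Eq.trans ?_ (Fintype.prod_equiv ((Fintype.equivFin α).trans (finCongr hcard)) _
    (fun i => Polynomial.X - Polynomial.C (A.charpoly.roots.toList.get i)) fun i => rfl).symm
  conv_lhs =>
    rw [hs.eq_prod_roots_of_monic A.charpoly_monic, ← Multiset.coe_toList A.charpoly.roots]
  rw [Multiset.map_coe, Multiset.prod_coe, ← List.prod_ofFn]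
  congr 1
  refine List.ext_get (by simp) (by simp)

lemma eq_zero_of_eval_eq_zero_of_separable [CharZero F] [Nonempty α] {f : MvPolynomial (α × α) F}
    (h : ∀ A : Matrix α α F, A.charpoly.Separable → eval (fun p => A p.1 p.2) f = 0) : f = 0 := by
  set N := Fintype.card α
  let R : MvPolynomial (α × α) F := Polynomial.resultant (charpoly.univ F α)
    (Polynomial.derivative (charpoly.univ F α)) N (N - 1)
  have hR : ∀ A : Matrix α α F,
      eval (fun p => A p.1 p.2) R ≠ 0 ↔ A.charpoly.Separable := by
    intro A
    have h1 : (charpoly.univ F α).map (eval fun p => A p.1 p.2) = A.charpoly :=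
      charpoly.univ_map_eval₂Hom α (RingHom.id F) fun p => A p.1 p.2
    have h2 : eval (fun p => A p.1 p.2) R =
        Polynomial.resultant A.charpoly (Polynomial.derivative A.charpoly) := by
      rw [← Polynomial.resultant_map_map, ← Polynomial.derivative_map, h1,
        Polynomial.natDegree_derivative, charpoly_natDegree_eq_dim]
    rw [h2, ne_eq, Polynomial.resultant_eq_zero_iff, Polynomial.Separable]
    simp [A.charpoly_monic.ne_zero]
  have hR0 : R ≠ 0 := by
    let φ : α ↪ F := (Fintype.equivFin α).toEmbedding.trans
      (Fin.valEmbedding.trans Nat.castEmbedding)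
    intro h0
    have := (hR (diagonal φ)).2 (by
      rw [charpoly_diagonal]
      exact Polynomial.separable_prod_X_sub_C_iff.2 φ.injective)
    simp [h0] at this
  have hfR : f * R = 0 := by
    refine MvPolynomial.funext fun x => ?_
    rw [map_mul, map_zero, mul_eq_zero, or_iff_not_imp_right]
    exact fun hx => h (Matrix.of fun a b => x (a, b)) ((hR _).1 hx)
  exact (mul_eq_zero.1 hfR).resolve_right hR0

/-- The restriction of a polynomial function on matrices to the diagonal matrices. -/
noncomputable def diagonalRestriction (f : MvPolynomial (α × α) F) : MvPolynomial α F :=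
  aeval (fun p : α × α => if p.1 = p.2 then X p.1 else 0) f

omit [Fintype α] in
lemma eval_diagonalRestriction (f : MvPolynomial (α × α) F) (lam : α → F) :
    eval lam (diagonalRestriction f) = eval (fun p => diagonal lam p.1 p.2) f := by
  rw [diagonalRestriction, aeval_def, eval_eval₂]
  simp only [diagonal_apply, apply_ite (eval lam), eval_X, map_zero]
  congr 1
  ext
  simp

omit [Fintype α] in
lemma totalDegree_diagonalRestriction_le (f : MvPolynomial (α × α) F) :
    (diagonalRestriction f).totalDegree ≤ f.totalDegree := by
  rw [diagonalRestriction, aeval_def, eval₂_eq]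
  refine totalDegree_finsetSum_le fun d hd => ?_
  refine (totalDegree_mul _ _).trans ?_
  rw [algebraMap_eq, totalDegree_C, zero_add]
  refine (totalDegree_finsetProd _ _).trans (le_trans ?_ (le_totalDegree hd))
  refine Finset.sum_le_sum fun p _ => (totalDegree_pow _ _).trans ?_
  split_ifs <;> simp

lemma diagonalRestriction_isSymmetric [Infinite F] {f : MvPolynomial (α × α) F}
    (hf : ∀ (g : GL α F) (A : Matrix α α F),
      eval (fun p => ((g : Matrix α α F) * A * ((g⁻¹ : GL α F) : Matrix α α F)) p.1 p.2) f =
        eval (fun p => A p.1 p.2) f) : (diagonalRestriction f).IsSymmetric := by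
  intro e
  refine MvPolynomial.funext fun lam => ?_
  rw [eval_rename, eval_diagonalRestriction, eval_diagonalRestriction]
  let g : GL α F := ⟨e.permMatrix F, (e⁻¹).permMatrix F, by
    rw [← permMatrix_mul]; simp, by rw [← permMatrix_mul]; simp⟩
  rw [← hf g (diagonal lam)]
  congr 2
  ext p
  simp only [g, Equiv.Perm.permMatrix, Units.inv_mk, PEquiv.toMatrix_toPEquiv_mul,
    PEquiv.mul_toMatrix_toPEquiv, submatrix_apply, diagonal_apply, id, Function.comp_apply,
    Equiv.Perm.inv_def, Equiv.symm_symm, e.injective.eq_iff]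

lemma eq_zero_of_diagonalRestriction_eq_zero [IsAlgClosed F] [CharZero F] [Nonempty α]
    {f : MvPolynomial (α × α) F}
    (hf : ∀ (g : GL α F) (A : Matrix α α F),
      eval (fun p => ((g : Matrix α α F) * A * ((g⁻¹ : GL α F) : Matrix α α F)) p.1 p.2) f =
        eval (fun p => A p.1 p.2) f) (h0 : diagonalRestriction f = 0) : f = 0 := by
  refine eq_zero_of_eval_eq_zero_of_separable fun A hA => ?_
  obtain ⟨g, lam, rfl⟩ := exists_eq_conj_diagonal_of_separable hA
  rw [hf, ← eval_diagonalRestriction, h0, map_zero]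

lemma rename_diagonalRestriction_eq_zero [Infinite F] {f : MvPolynomial (α × α) F} {r : ℕ}
    (hf : ∀ (A : Matrix α α F) (lam : α → F),
      A.charpoly = ∏ i, (Polynomial.X - Polynomial.C (lam i)) →
      (Set.range lam).ncard ≤ r → eval (fun p => A p.1 p.2) f = 0)
    (σ : α → α) (hσ : (Finset.univ.image σ).card ≤ r) :
    rename σ (diagonalRestriction f) = 0 := by
  refine MvPolynomial.funext fun y => ?_
  rw [eval_rename, eval_diagonalRestriction, map_zero]
  refine hf _ _ (charpoly_diagonal _) (le_trans ?_ hσ)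
  rw [Set.range_comp, ← Set.image_univ, ← Finset.coe_univ, ← Finset.coe_image,
    ← Set.ncard_coe_finset]
  exact Set.ncard_image_le (Finset.finite_toSet _)

end Matrices

section Subdiscriminant

lemma eval_sDiscVal_X {n k : ℕ} (lam : Fin n → F) :
    eval lam (sDiscVal n k (X : Fin n → MvPolynomial (Fin n) F)) = sDiscVal n k lam := by
  simp [sDiscVal]

lemma totalDegree_sDiscVal_X_le (n k : ℕ) :
    (sDiscVal n k (X : Fin n → MvPolynomial (Fin n) F)).totalDegree ≤
      (n - k) * (n - k - 1) := by
  refine totalDegree_finsetSum_le fun s hs => ?_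
  rw [totalDegree_prod_X_sub_X_pow (by simp) fun _ => 2, Finset.sum_const, smul_eq_mul, mul_comm,
    two_mul_card_filter_lt, (Finset.mem_powersetCard.1 hs).2]

lemma rename_sDiscVal_X_eq_zero {n k : ℕ} {σ : Fin n → Fin n}
    (hσ : (Finset.univ.image σ).card < n - k) :
    rename σ (sDiscVal n k (X : Fin n → MvPolynomial (Fin n) F)) = 0 := by
  rw [sDiscVal, map_sum]
  refine Finset.sum_eq_zero fun s hs => ?_
  rw [map_prod]
  obtain ⟨a, ha, b, hb, hab, hσab⟩ := Finset.exists_ne_map_eq_of_card_lt_of_maps_to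
    (t := Finset.univ.image σ) (hσ.trans_eq (Finset.mem_powersetCard.1 hs).2.symm)
    (fun x _ => Finset.mem_image_of_mem σ (Finset.mem_univ x))
  wlog hlt : a < b generalizing a b
  · exact this b hb a ha hab.symm hσab.symm (hab.lt_or_gt.resolve_left hlt)
  refine Finset.prod_eq_zero (i := (a, b)) (by simp [ha, hb, hlt]) ?_
  simp [hσab]

lemma sDiscVal_X_ne_zero [CharZero F] {n k : ℕ} :
    sDiscVal n k (X : Fin n → MvPolynomial (Fin n) F) ≠ 0 := by
  have hpos : 0 < sDiscVal n k (fun i : Fin n => (i : ℤ)) := by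
    refine Finset.sum_pos (fun s _ => Finset.prod_pos fun p hp => ?_)
      (Finset.powersetCard_nonempty.2 (by simp))
    have := (Finset.mem_filter.1 hp).2
    have : (p.1 : ℤ) - p.2 ≠ 0 := by omega
    positivity
  intro h
  have h1 := eval_sDiscVal_X (F := F) (k := k) fun i : Fin n => ((i : ℤ) : F)
  rw [h, map_zero] at h1
  have h2 : sDiscVal n k (fun i : Fin n => ((i : ℤ) : F)) =
      ((sDiscVal n k (fun i : Fin n => (i : ℤ)) : ℤ) : F) := by
    simp [sDiscVal]
  rw [h2, eq_comm, Int.cast_eq_zero] at h1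
  exact hpos.ne' h1

end Subdiscriminant

end SymmetricVanishing

/-- Over an algebraically closed field of characteristic zero, any conjugation-invariant
polynomial of degree `< (n−k)(n−k−1)` vanishing on all matrices with at most `n−k−1`
distinct eigenvalues is zero, and every conjugation-invariant homogeneous polynomial of
degree `(n−k)(n−k−1)` vanishing on that set is a scalar multiple of `sDisc_k`. -/
theorem stmt11 (F : Type*) [Field F] [CharZero F] [IsAlgClosed F]
    (n k : ℕ) (hn : 2 ≤ n) (hk : k ≤ n - 2)
    (D : MvPolynomial (Fin n × Fin n) F)
    (hD : ∀ (A : Matrix (Fin n) (Fin n) F) (lam : Fin n → F),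
      A.charpoly = ∏ i, (Polynomial.X - Polynomial.C (lam i)) →
      MvPolynomial.eval (fun p => A p.1 p.2) D = sDiscVal n k lam) :
    (∀ f : MvPolynomial (Fin n × Fin n) F,
      (∀ g : GL (Fin n) F, ∀ A : Matrix (Fin n) (Fin n) F,
        MvPolynomial.eval (fun p => ((g : Matrix (Fin n) (Fin n) F) * A *
          ((g⁻¹ : GL (Fin n) F) : Matrix (Fin n) (Fin n) F)) p.1 p.2) f =
        MvPolynomial.eval (fun p => A p.1 p.2) f) →
      (∀ (A : Matrix (Fin n) (Fin n) F) (lam : Fin n → F),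
        A.charpoly = ∏ i, (Polynomial.X - Polynomial.C (lam i)) →
        (Set.range lam).ncard ≤ n - k - 1 →
        MvPolynomial.eval (fun p => A p.1 p.2) f = 0) →
      f.totalDegree < (n - k) * (n - k - 1) → f = 0) ∧
    (∀ f : MvPolynomial (Fin n × Fin n) F,
      (∀ g : GL (Fin n) F, ∀ A : Matrix (Fin n) (Fin n) F,
        MvPolynomial.eval (fun p => ((g : Matrix (Fin n) (Fin n) F) * A *
          ((g⁻¹ : GL (Fin n) F) : Matrix (Fin n) (Fin n) F)) p.1 p.2) f =
        MvPolynomial.eval (fun p => A p.1 p.2) f) →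
      (∀ (A : Matrix (Fin n) (Fin n) F) (lam : Fin n → F),
        A.charpoly = ∏ i, (Polynomial.X - Polynomial.C (lam i)) →
        (Set.range lam).ncard ≤ n - k - 1 →
        MvPolynomial.eval (fun p => A p.1 p.2) f = 0) →
      f.IsHomogeneous ((n - k) * (n - k - 1)) →
      ∃ c : F, f = c • D) := by
  have : NeZero n := ⟨by omega⟩
  obtain ⟨r, hr⟩ : ∃ r, n - k = r + 1 := ⟨n - k - 1, by omega⟩
  simp only [hr, Nat.add_sub_cancel]
  refine ⟨fun f hinv hvan hdeg => ?_, fun f hinv hvan hhom => ?_⟩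
  · exact eq_zero_of_diagonalRestriction_eq_zero hinv
      (eq_zero_of_totalDegree_lt (diagonalRestriction_isSymmetric hinv)
        (rename_diagonalRestriction_eq_zero hvan)
        ((totalDegree_diagonalRestriction_le f).trans_lt hdeg))
  · have hDdiag : diagonalRestriction D = sDiscVal n k MvPolynomial.X :=
      MvPolynomial.funext fun lam => by
        rw [eval_diagonalRestriction, eval_sDiscVal_X, hD _ _ (Matrix.charpoly_diagonal lam)]
    have hDinv : ∀ (g : GL (Fin n) F) (A : Matrix (Fin n) (Fin n) F),
        MvPolynomial.eval (fun p => ((g : Matrix (Fin n) (Fin n) F) * A *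
          ((g⁻¹ : GL (Fin n) F) : Matrix (Fin n) (Fin n) F)) p.1 p.2) D =
        MvPolynomial.eval (fun p => A p.1 p.2) D := by
      intro g A
      obtain ⟨lam, hlam⟩ := exists_charpoly_eq_prod A
      rw [hD A lam hlam]
      refine hD _ lam (Eq.trans ?_ hlam)
      rw [Matrix.coe_units_inv, Matrix.charpoly_units_conj]
    obtain ⟨c, hc⟩ := exists_eq_smul (r := r) (diagonalRestriction_isSymmetric hinv)
      (diagonalRestriction_isSymmetric hDinv) (rename_diagonalRestriction_eq_zero hvan)
      (fun σ hσ => by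
        rw [hDdiag]
        exact rename_sDiscVal_X_eq_zero (by omega))
      ((totalDegree_diagonalRestriction_le f).trans hhom.totalDegree_le)
      (by simpa only [hDdiag, hr, Nat.add_sub_cancel] using totalDegree_sDiscVal_X_le (F := F) n k)
      (by rw [Fintype.card_fin]; omega) (hDdiag ▸ sDiscVal_X_ne_zero)
    refine ⟨c, sub_eq_zero.1 (eq_zero_of_diagonalRestriction_eq_zero (fun g A => ?_) ?_)⟩
    · rw [map_sub, map_sub, MvPolynomial.smul_eval, MvPolynomial.smul_eval, hinv, hDinv]
    · rw [diagonalRestriction, map_sub, map_smul, sub_eq_zero]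
      exact hc
end

section
/- Over a field F of characteristic zero and with L₀ the set of n×n matrices having a repeated eigenvalue, the vanishing ideal I(L₀) ⊆ F[Matₙ] contains no non-zero polynomial of degree less than n(n−1); in particular I(L₀) is generated by the discriminant of the characteristic polynomial. -/
/-- The restriction of a multivariate polynomial to the line `t ↦ a + t b`. -/
noncomputable def MvPolynomial.restrictLine {σ F : Type*} [Field F] (a b : σ → F)
    (f : MvPolynomial σ F) : Polynomial F :=
  MvPolynomial.aeval (fun p => Polynomial.C (a p) + Polynomial.C (b p) * Polynomial.X) f

/-- The square matrices with a repeated eigenvalue. -/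
def Matrix.repeatedEigenvalueLocus (F : Type*) [Field F] (n : ℕ) :
    Set (Matrix (Fin n) (Fin n) F) :=
  {A | (A.charpoly.rootSet F).ncard ≤ n - 1}

namespace MvPolynomial

variable {σ F : Type*} [Field F]

theorem eval_restrictLine (a b : σ → F) (f : MvPolynomial σ F) (t : F) :
    (f.restrictLine a b).eval t = eval (fun p => a p + t * b p) f := by
  rw [restrictLine, ← Polynomial.coe_evalRingHom, map_aeval, eval]
  congr 2
  · ext; simp
  · ext p; simp [mul_comm t]

theorem natDegree_restrictLine_le (a b : σ → F) (f : MvPolynomial σ F) :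
    (f.restrictLine a b).natDegree ≤ f.totalDegree := by
  have := aeval_natDegree_le (m := f.totalDegree) (n := 1) f le_rfl
    (fun p => Polynomial.C (a p) + Polynomial.C (b p) * Polynomial.X) (fun p => by
      compute_degree)
  simpa [restrictLine] using this

theorem eval_derivative_restrictLine [Fintype σ] (a b : σ → F) (f : MvPolynomial σ F) (t : F) :
    (Polynomial.derivative (f.restrictLine a b)).eval t =
      ∑ p, eval (fun q => a q + t * b q) (pderiv p f) * b p := by
  classical
  induction f using MvPolynomial.induction_on with
  | C c => simp [restrictLine]
  | add f g hf hg =>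
    have : (f + g).restrictLine a b = f.restrictLine a b + g.restrictLine a b := by
      simp [restrictLine]
    simp [this, hf, hg, add_mul, Finset.sum_add_distrib]
  | mul_X f i hf =>
    have : (f * X i).restrictLine a b =
        f.restrictLine a b * (Polynomial.C (a i) + Polynomial.C (b i) * Polynomial.X) := by
      simp [restrictLine]
    simp only [this, Polynomial.derivative_mul, Polynomial.eval_add, Polynomial.eval_mul, hf,
      eval_restrictLine, Derivation.leibniz, pderiv_X, smul_eq_mul, map_add, map_mul,
      add_mul _ _ (b _), eval_X, Polynomial.derivative_C,
      Polynomial.derivative_X, Polynomial.eval_C, Polynomial.eval_X, Finset.sum_add_distrib]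
    rw [add_comm]
    congr 1
    · rw [Finset.sum_eq_single i] <;> simp +contextual [eq_comm]
    · rw [Finset.sum_mul]
      refine Finset.sum_congr rfl fun p _ => ?_
      ring

theorem sum_pderiv_mul_eq_zero_of_forall_eval_line [Fintype σ] [Infinite F] (a b : σ → F)
    (f : MvPolynomial σ F) (h : ∀ s : F, eval (fun p => a p + s * b p) f = 0) :
    ∑ p, eval a (pderiv p f) * b p = 0 := by
  have h0 : f.restrictLine a b = 0 :=
    Polynomial.funext fun s => by simpa [eval_restrictLine] using h s
  simpa [h0] using (eval_derivative_restrictLine a b f 0).symm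

theorem IsHomogeneous.eval_const_mul {f : MvPolynomial σ F} {k : ℕ} (hf : f.IsHomogeneous k)
    (t : F) (a : σ → F) : eval (fun p => t * a p) f = t ^ k * eval a f := by
  rw [eval_eq, eval_eq, Finset.mul_sum]
  refine Finset.sum_congr rfl fun d hd => ?_
  have hdeg : ∑ i ∈ d.support, d i = k := by
    simpa [Finsupp.weight_apply, Finsupp.sum] using hf (mem_support_iff.mp hd)
  simp only [mul_pow, Finset.prod_mul_distrib, Finset.prod_pow_eq_pow_sum, hdeg]
  ring

/-- If `f` scales like `t ^ d`, then its total degree is at most `d`. -/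
theorem totalDegree_le_of_eval_smul [Infinite F] (f : MvPolynomial σ F) (d : ℕ)
    (h : ∀ (t : F) (a : σ → F), eval (fun p => t * a p) f = t ^ d * eval a f) :
    f.totalDegree ≤ d := by
  by_contra! hd
  have hf : f ≠ 0 := by rintro rfl; simp at hd
  have hc : homogeneousComponent f.totalDegree f ≠ 0 := by
    obtain ⟨m, hm, hdeg⟩ := Finset.exists_mem_eq_sup f.support (by simpa using hf)
      (fun s => s.sum fun _ e => e)
    intro h0
    have := congrArg (coeff m) h0
    rw [coeff_homogeneousComponent, if_pos] at this
    · simp at this hm; exact hm this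
    · rw [totalDegree, hdeg]; rfl
  obtain ⟨a, ha⟩ : ∃ a, eval a (homogeneousComponent f.totalDegree f) ≠ 0 := by
    by_contra! h0
    exact hc (MvPolynomial.funext (by simpa using h0))
  have key : ∑ k ∈ Finset.range (f.totalDegree + 1),
      Polynomial.C (eval a (homogeneousComponent k f)) * Polynomial.X ^ k =
        Polynomial.C (eval a f) * Polynomial.X ^ d := by
    refine Polynomial.funext fun t => ?_
    simp only [Polynomial.eval_finsetSum, Polynomial.eval_mul, Polynomial.eval_C,
      Polynomial.eval_pow, Polynomial.eval_X]
    rw [mul_comm, ← h t a]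
    conv_rhs => rw [← sum_homogeneousComponent f, map_sum]
    refine Finset.sum_congr rfl fun k _ => ?_
    rw [(homogeneousComponent_isHomogeneous k f).eval_const_mul, mul_comm]
  have := congrArg (Polynomial.coeff · f.totalDegree) key
  simp [Polynomial.coeff_C_mul, Polynomial.coeff_X_pow, hd.ne'] at this
  exact ha this

end MvPolynomial

namespace Matrix
variable {F : Type*} [Field F] {n : ℕ}

theorem rootSet_charpoly_eq_range {A : Matrix (Fin n) (Fin n) F} {lam : Fin n → F}
    (h : A.charpoly = ∏ i, (Polynomial.X - Polynomial.C (lam i))) :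
    A.charpoly.rootSet F = Set.range lam := by
  ext x
  rw [Polynomial.mem_rootSet_of_ne A.charpoly_monic.ne_zero, h]
  simp [Finset.prod_eq_zero_iff, sub_eq_zero, eq_comm (a := x)]

theorem mem_repeatedEigenvalueLocus_of_rootSet_subset {A : Matrix (Fin n) (Fin n) F}
    {lam : Fin n → F} (h : A.charpoly.rootSet F ⊆ Set.range lam)
    (hlam : ¬ Function.Injective lam) : A ∈ repeatedEigenvalueLocus F n := by
  classical
  have h1 : (Set.range lam).ncard < n := by
    have h2 : (Finset.univ.image lam).card ≠ n := fun hc =>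
      
      hlam (Set.injOn_univ.mp (by
        simpa using Finset.card_image_iff.mp (hc.trans (Finset.card_fin n).symm)))
    have h3 := Finset.card_image_le (s := Finset.univ) (f := lam)
    rw [Finset.card_fin] at h3
    have : Set.range lam = ((Finset.univ.image lam : Finset F) : Set F) := by simp
    rw [this, Set.ncard_coe_finset]
    omega
  have := Set.ncard_le_ncard h (Set.finite_range lam)
  exact this.trans (by omega)

theorem mem_repeatedEigenvalueLocus_iff (hn : n ≠ 0) {A : Matrix (Fin n) (Fin n) F}
    {lam : Fin n → F} (h : A.charpoly = ∏ i, (Polynomial.X - Polynomial.C (lam i))) :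
    A ∈ repeatedEigenvalueLocus F n ↔ ¬ Function.Injective lam := by
  refine ⟨fun hA hinj => ?_,
    mem_repeatedEigenvalueLocus_of_rootSet_subset (rootSet_charpoly_eq_range h).subset⟩
  have hA : (A.charpoly.rootSet F).ncard ≤ n - 1 := hA
  rw [rootSet_charpoly_eq_range h, ← Set.image_univ, Set.ncard_image_of_injective _ hinj] at hA
  simp at hA
  omega

theorem exists_charpoly_eq_prod [IsAlgClosed F] (A : Matrix (Fin n) (Fin n) F) :
    ∃ lam : Fin n → F, A.charpoly = ∏ i, (Polynomial.X - Polynomial.C (lam i)) := by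
  have hs := IsAlgClosed.splits A.charpoly
  have hcard : A.charpoly.roots.toList.length = n := by
    rw [Multiset.length_toList, ← hs.natDegree_eq_card_roots]; simp
  obtain ⟨lam, hlam⟩ : ∃ lam : Fin n → F, List.ofFn lam = A.charpoly.roots.toList := by
    generalize A.charpoly.roots.toList = l at hcard
    subst hcard
    exact ⟨l.get, List.ofFn_get l⟩
  refine ⟨lam, ?_⟩
  rw [hs.eq_prod_roots_of_monic A.charpoly_monic, ← Multiset.coe_toList A.charpoly.roots, ← hlam]
  simp [List.map_ofFn, List.prod_ofFn]

theorem charpoly_smul_eq_prod [Infinite F] (t : F) {A : Matrix (Fin n) (Fin n) F}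
    {lam : Fin n → F} (h : A.charpoly = ∏ i, (Polynomial.X - Polynomial.C (lam i))) :
    (t • A).charpoly = ∏ i, (Polynomial.X - Polynomial.C (t * lam i)) := by
  rcases eq_or_ne t 0 with rfl | ht
  · simp
  refine Polynomial.funext fun x => ?_
  have h1 : scalar (Fin n) x - t • A = t • (scalar (Fin n) (t⁻¹ * x) - A) := by
    ext i j
    by_cases hij : i = j <;> simp [hij, mul_sub, ht]
  rw [eval_charpoly, h1, det_smul, ← eval_charpoly, h]
  simp only [Polynomial.eval_prod, Polynomial.eval_sub, Polynomial.eval_X, Polynomial.eval_C,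
    Fintype.card_fin]
  rw [← Fin.prod_const n t, ← Finset.prod_mul_distrib]
  exact Finset.prod_congr rfl fun i _ => by field_simp

/-- A matrix with distinct eigenvalues is diagonalizable. -/
theorem exists_eq_conj_diagonal {A : Matrix (Fin n) (Fin n) F} {lam : Fin n → F}
    (h : A.charpoly = ∏ i, (Polynomial.X - Polynomial.C (lam i)))
    (hlam : Function.Injective lam) :
    ∃ P : (Matrix (Fin n) (Fin n) F)ˣ, A = P.val * diagonal lam * P⁻¹.val := by
  have hv : ∀ i, ∃ v : Fin n → F, Module.End.HasEigenvector (toLin' A) (lam i) v := fun i => by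
    apply Module.End.HasEigenvalue.exists_hasEigenvector
    rw [Module.End.hasEigenvalue_iff_isRoot_charpoly, charpoly_toLin', h]
    simp [Polynomial.IsRoot, Polynomial.eval_prod, Finset.prod_eq_zero_iff, sub_eq_zero]
  choose v hv using hv
  have hli := Module.End.eigenvectors_linearIndependent' (toLin' A) lam hlam v hv
  obtain ⟨P, hP⟩ : IsUnit (of v)ᵀ := linearIndependent_cols_iff_isUnit.mp hli
  refine ⟨P, ?_⟩
  have : A * P.val = P.val * diagonal lam := by
    rw [hP]
    ext i j
    have := congrFun (hv j).apply_eq_smul i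
    rw [mul_diagonal]
    simpa [mul_apply, toLin'_apply, mulVec, dotProduct, mul_comm] using this
  rw [← this, mul_assoc, Units.mul_inv, mul_one]

/-- Adding a commuting nilpotent to a diagonal matrix creates no new eigenvalues. -/
theorem conj_diagonal_add_mem_repeatedEigenvalueLocus (P : (Matrix (Fin n) (Fin n) F)ˣ)
    {lam : Fin n → F} (hlam : ¬ Function.Injective lam) {N : Matrix (Fin n) (Fin n) F}
    (hN : IsNilpotent N) (hc : Commute (diagonal lam) N) :
    P.val * (diagonal lam + N) * P⁻¹.val ∈ repeatedEigenvalueLocus F n := by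
  refine mem_repeatedEigenvalueLocus_of_rootSet_subset (lam := lam) (fun x hx => ?_) hlam
  rw [coe_units_inv, charpoly_units_conj, Polynomial.mem_rootSet_of_ne (charpoly_monic _).ne_zero,
    Polynomial.coe_aeval_eq_eval, eval_charpoly] at hx
  by_contra hx'
  have hu : IsUnit (scalar (Fin n) x - diagonal lam) := by
    rw [scalar_apply, diagonal_sub, isUnit_diagonal, Pi.isUnit_iff]
    intro i
    rw [isUnit_iff_ne_zero, sub_ne_zero]
    rintro rfl
    exact hx' ⟨i, rfl⟩
  have hu' : IsUnit (scalar (Fin n) x - diagonal lam + -N) :=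
    hN.neg.isUnit_add_left_of_commute hu
      (((scalar_commute x (fun _ => Commute.all _ _) N).sub_left hc).neg_right.symm)
  rw [isUnit_iff_isUnit_det, ← sub_eq_add_neg, sub_sub, hx] at hu'
  exact not_isUnit_zero hu'

theorem diagonal_add_smul (lam mu : Fin n → F) (s : F) :
    diagonal (lam + s • mu) = diagonal lam + s • diagonal mu := by
  ext k l
  by_cases h : k = l <;> simp [h]

/-- At a diagonalizable matrix with two equal eigenvalues, the differential of a polynomial that
vanishes on all matrices with a repeated eigenvalue kills simultaneously diagonalizable
directions. -/
theorem sum_pderiv_mul_conj_diagonal_eq_zero [CharZero F]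
    {f : MvPolynomial (Fin n × Fin n) F}
    (hf : ∀ A ∈ repeatedEigenvalueLocus F n, MvPolynomial.eval (fun p => A p.1 p.2) f = 0)
    (P : (Matrix (Fin n) (Fin n) F)ˣ) (lam nu : Fin n → F) {i j : Fin n} (hij : i ≠ j)
    (hlam : lam i = lam j) :
    ∑ p, MvPolynomial.eval (fun q => (P.val * diagonal lam * P⁻¹.val) q.1 q.2)
      (MvPolynomial.pderiv p f) * (P.val * diagonal nu * P⁻¹.val) p.1 p.2 = 0 := by
  set w : Fin n × Fin n → F := fun p =>
    MvPolynomial.eval (fun q => (P.val * diagonal lam * P⁻¹.val) q.1 q.2)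
      (MvPolynomial.pderiv p f)
  let L : Matrix (Fin n) (Fin n) F →+ F :=
    { toFun := fun N => ∑ p, w p * (P.val * N * P⁻¹.val) p.1 p.2
      map_zero' := by simp
      map_add' := fun M N => by simp [mul_add, add_mul, Finset.sum_add_distrib] }
  have hL : ∀ (mu : Fin n → F) (N : Matrix (Fin n) (Fin n) F), mu i = mu j → IsNilpotent N →
      (∀ ka : Fin n → F, ka i = ka j → Commute (diagonal ka) N) → L (diagonal mu + N) = 0 := by
    intro mu N hmu hN hc
    refine MvPolynomial.sum_pderiv_mul_eq_zero_of_forall_eval_line _ _ f fun s => ?_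
    have hka : (lam + s • mu) i = (lam + s • mu) j := by simp [hlam, hmu]
    have := hf _ (conj_diagonal_add_mem_repeatedEigenvalueLocus P (lam := lam + s • mu)
      (fun h => hij (h hka)) (hN.smul s) ((hc _ hka).smul_right s))
    convert this using 3
    funext p
    simp only [diagonal_add_smul, mul_add, add_mul, mul_smul_comm, smul_mul_assoc, add_apply,
      smul_apply, smul_eq_mul]
    ring
  have hvec : ∀ u v : Fin n → F, v ⬝ᵥ u = 0 → (∀ k, k ≠ i → k ≠ j → u k = 0 ∧ v k = 0) →
      L (vecMulVec u v) = 0 := by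
    intro u v huv hsupp
    have := hL 0 (vecMulVec u v) rfl ⟨2, by
      rw [pow_two, vecMulVec_mul_vecMulVec, huv, zero_smul, vecMulVec_zero]⟩ ?_
    · simpa using this
    intro ka hka
    have hu : ∀ k, ka k * u k = ka i * u k := fun k => by
      by_cases h1 : k = i
      · rw [h1]
      by_cases h2 : k = j
      · rw [h2, hka]
      simp [hsupp k h1 h2]
    have hv : ∀ k, v k * ka k = ka i * v k := fun k => by
      by_cases h1 : k = i
      · rw [h1, mul_comm]
      by_cases h2 : k = j
      · rw [h2, hka, mul_comm]
      simp [hsupp k h1 h2]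
    ext k l
    rw [diagonal_mul, mul_diagonal, vecMulVec_apply, mul_assoc, hv, ← mul_assoc, hu]
    ring
  have hdiag : ∀ mu : Fin n → F, mu i = mu j → L (diagonal mu) = 0 := fun mu hmu => by
    simpa using hL mu 0 hmu IsNilpotent.zero fun _ _ => Commute.zero_right _
  set c : F := (nu i - nu j) / 2
  have hdec : diagonal nu = diagonal (nu - c • (Pi.single i 1 - Pi.single j 1)) +
      (vecMulVec (c • (Pi.single i 1 + Pi.single j 1)) (Pi.single i 1 - Pi.single j 1) +
        vecMulVec (c • Pi.single i 1) (Pi.single j 1) +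
        vecMulVec (-c • Pi.single j 1) (Pi.single i 1)) := by
    ext k l
    simp only [diagonal_apply, add_apply, vecMulVec_apply, Pi.sub_apply, Pi.add_apply,
      Pi.smul_apply, Pi.single_apply, smul_eq_mul]
    split_ifs <;> subst_vars <;> simp_all
  change L (diagonal nu) = 0
  rw [hdec, map_add, map_add, map_add, hdiag _ ?_, hvec, hvec, hvec]
  · simp
  all_goals first
    | simp +contextual [hij, hij.symm]; done
    | skip
  simp [hij, hij.symm, c]
  ring

/-- The number of strictly increasing pairs of indices is `n (n - 1) / 2`. -/
theorem two_mul_card_filter_lt (n : ℕ) :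
    2 * ((Finset.univ : Finset (Fin n × Fin n)).filter (fun p => p.1 < p.2)).card =
      n * (n - 1) := by
  have h1 : ((Finset.univ : Finset (Fin n × Fin n)).filter (fun p => p.2 < p.1)).card =
      ((Finset.univ : Finset (Fin n × Fin n)).filter (fun p => p.1 < p.2)).card :=
    Finset.card_equiv (Equiv.prodComm _ _) (by simp)
  have h2 := Finset.offDiag_card (s := (Finset.univ : Finset (Fin n)))
  have h3 : (Finset.univ : Finset (Fin n)).offDiag =
      (Finset.univ : Finset (Fin n × Fin n)).filter (fun p => p.1 < p.2) ∪
      (Finset.univ : Finset (Fin n × Fin n)).filter (fun p => p.2 < p.1) := by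
    ext p; simp [lt_or_lt_iff_ne]
  rw [h3, Finset.card_union_of_disjoint, h1, Finset.card_fin] at h2
  · rw [two_mul, h2, Nat.mul_sub_one]
  · rw [Finset.disjoint_filter]; exact fun p _ hlt hgt => lt_asymm hlt hgt

/-- Some direction separates the parameters at which pairs of coordinates collide. -/
theorem exists_direction_separating_collisions [Infinite F] {lam : Fin n → F}
    (hlam : Function.Injective lam) :
    ∃ nu : Fin n → F, (∀ i j, i < j → nu i ≠ nu j) ∧
      ∀ p q : Fin n × Fin n, p.1 < p.2 → q.1 < q.2 → p ≠ q →
        (lam p.1 - lam p.2) * (nu q.1 - nu q.2) ≠ (lam q.1 - lam q.2) * (nu p.1 - nu p.2) := by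
  let pr : Fin n → Module.Dual F (Fin n → F) := fun i => LinearMap.proj i
  obtain ⟨nu, hnu⟩ := Module.Dual.exists_forall_ne_zero_of_forall_exists
    (ι := {p : Fin n × Fin n // p.1 < p.2} ⊕
      {pq : (Fin n × Fin n) × (Fin n × Fin n) // pq.1.1 < pq.1.2 ∧ pq.2.1 < pq.2.2 ∧ pq.1 ≠ pq.2})
    (Sum.elim (fun p => pr p.1.1 - pr p.1.2) fun pq =>
      (lam pq.1.1.1 - lam pq.1.1.2) • (pr pq.1.2.1 - pr pq.1.2.2) -
        (lam pq.1.2.1 - lam pq.1.2.2) • (pr pq.1.1.1 - pr pq.1.1.2)) (by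
    rintro (⟨⟨i, j⟩, hij⟩ | ⟨⟨⟨i, j⟩, ⟨k, l⟩⟩, hij, hkl, hne⟩)
    · exact ⟨Pi.single i 1, by simp [pr, (show i < j from hij).ne']⟩
    · have hij : i < j := hij
      have hkl : k < l := hkl
      have h0 : lam i - lam j ≠ 0 := sub_ne_zero.mpr (hlam.ne hij.ne)
      by_cases hk : k = i ∨ k = j
      · have hl : l ≠ i ∧ l ≠ j := by
          simp only [ne_eq, Prod.mk.injEq] at hne
          grind
        exact ⟨Pi.single l 1, by simp [pr, hl.1.symm, hl.2.symm, hkl.ne, sub_eq_zero,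
          hlam.eq_iff, hij.ne']⟩
      · push Not at hk
        exact ⟨Pi.single k 1, by simp [pr, hk.1.symm, hk.2.symm, hkl.ne', h0]⟩)
  refine ⟨nu, fun i j hij => ?_, fun p q hp hq hpq => ?_⟩
  · simpa [pr, sub_eq_zero] using hnu (.inl ⟨(i, j), hij⟩)
  · simpa [pr, sub_eq_zero] using hnu (.inr ⟨(p, q), hp, hq, hpq⟩)

/-- A polynomial vanishing on all matrices with a repeated eigenvalue, but not at some matrix with
distinct eigenvalues, has degree at least `n (n - 1)`. -/
theorem le_totalDegree_of_eval_ne_zero [CharZero F] {f : MvPolynomial (Fin n × Fin n) F}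
    (hf : ∀ A ∈ repeatedEigenvalueLocus F n, MvPolynomial.eval (fun p => A p.1 p.2) f = 0)
    {A : Matrix (Fin n) (Fin n) F} {lam : Fin n → F}
    (hA : A.charpoly = ∏ i, (Polynomial.X - Polynomial.C (lam i)))
    (hlam : Function.Injective lam) (hfA : MvPolynomial.eval (fun p => A p.1 p.2) f ≠ 0) :
    n * (n - 1) ≤ f.totalDegree := by
  obtain ⟨P, hP⟩ := exists_eq_conj_diagonal hA hlam
  obtain ⟨nu, hnu, hsep⟩ := exists_direction_separating_collisions hlam
  set B := P.val * diagonal nu * P⁻¹.val with hB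
  set u := f.restrictLine (fun p => A p.1 p.2) (fun p => B p.1 p.2) with hu
  have hline : ∀ t : F, (fun p : Fin n × Fin n => A p.1 p.2 + t * B p.1 p.2) =
      fun p => (P.val * diagonal (lam + t • nu) * P⁻¹.val) p.1 p.2 := fun t => by
    funext p
    simp [diagonal_add_smul, mul_add, add_mul, hP, hB]
  have hu0 : u ≠ 0 := by
    intro h
    apply hfA
    have := MvPolynomial.eval_restrictLine (fun p => A p.1 p.2) (fun p => B p.1 p.2) f 0
    rw [← hu, h] at this
    simpa using this.symm
  let S := (Finset.univ : Finset (Fin n × Fin n)).filter (fun p => p.1 < p.2)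
  let tt : Fin n × Fin n → F := fun p => -(lam p.1 - lam p.2) / (nu p.1 - nu p.2)
  have hroot : ∀ p ∈ S, (Polynomial.X - Polynomial.C (tt p)) ^ 2 ∣ u := by
    intro p hp
    have hp : p.1 < p.2 := by simpa [S] using hp
    have hne : nu p.1 - nu p.2 ≠ 0 := sub_ne_zero.mpr (hnu _ _ hp)
    have hcol : (lam + tt p • nu) p.1 = (lam + tt p • nu) p.2 := by
      simp only [tt, Pi.add_apply, Pi.smul_apply, smul_eq_mul]
      field_simp
      ring
    rw [← Polynomial.le_rootMultiplicity_iff hu0]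
    refine (Polynomial.one_lt_rootMultiplicity_iff_isRoot hu0).mpr ⟨?_, ?_⟩
    · rw [Polynomial.IsRoot, hu, MvPolynomial.eval_restrictLine, hline]
      simpa using hf _ (conj_diagonal_add_mem_repeatedEigenvalueLocus P (N := 0)
        (fun h => hp.ne (h hcol)) IsNilpotent.zero (Commute.zero_right _))
    · rw [Polynomial.IsRoot, hu, MvPolynomial.eval_derivative_restrictLine, hline]
      exact sum_pderiv_mul_conj_diagonal_eq_zero hf P _ nu hp.ne hcol
  have htt : Set.InjOn tt S := by
    intro p hp q hq h
    have hp : p.1 < p.2 := by simpa [S] using hp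
    have hq : q.1 < q.2 := by simpa [S] using hq
    by_contra hpq
    refine hsep p q hp hq hpq ?_
    have h1 := sub_ne_zero.mpr (hnu _ _ hp)
    have h2 := sub_ne_zero.mpr (hnu _ _ hq)
    simp only [tt] at h
    rw [div_eq_div_iff h1 h2] at h
    linear_combination -h
  have hdvd : ∏ p ∈ S, (Polynomial.X - Polynomial.C (tt p)) ^ 2 ∣ u := by
    refine Finset.prod_dvd_of_coprime (fun p hp q hq hpq => ?_) hroot
    exact (Polynomial.isCoprime_X_sub_C_of_isUnit_sub
      (sub_ne_zero.mpr fun h => hpq (htt hp hq h)).isUnit).pow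
  have hdeg := Polynomial.natDegree_le_of_dvd hdvd hu0
  rw [Polynomial.natDegree_prod_of_monic _ _ fun p _ => (Polynomial.monic_X_sub_C _).pow 2] at hdeg
  simp only [Polynomial.natDegree_pow, Polynomial.natDegree_X_sub_C, Finset.sum_const,
    smul_eq_mul, mul_one] at hdeg
  rw [← two_mul_card_filter_lt, mul_comm]
  exact hdeg.trans (MvPolynomial.natDegree_restrictLine_le _ _ f)

end Matrix

/-- Over an algebraically closed field of characteristic zero, the vanishing ideal of the
set `L₀` of `n×n` matrices with a repeated eigenvalue contains no non-zero polynomial of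
degree less than `n(n−1)`, and it is generated by the discriminant `Disc` of the
characteristic polynomial. -/
theorem stmt17 (F : Type*) [Field F] [CharZero F] [IsAlgClosed F] (n : ℕ) (hn : 2 ≤ n)
    (D : MvPolynomial (Fin n × Fin n) F)
    (hD : ∀ (A : Matrix (Fin n) (Fin n) F) (lam : Fin n → F),
      A.charpoly = ∏ i, (Polynomial.X - Polynomial.C (lam i)) →
      MvPolynomial.eval (fun p => A p.1 p.2) D =
        ∏ p ∈ (Finset.univ : Finset (Fin n × Fin n)).filter (fun p => p.1 < p.2),
          (lam p.1 - lam p.2) ^ 2) :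
    (∀ f : MvPolynomial (Fin n × Fin n) F, f ≠ 0 →
      (∀ A : Matrix (Fin n) (Fin n) F, (A.charpoly.rootSet F).ncard ≤ n - 1 →
        MvPolynomial.eval (fun p => A p.1 p.2) f = 0) →
      n * (n - 1) ≤ f.totalDegree) ∧
    (∀ f : MvPolynomial (Fin n × Fin n) F,
      (∀ A : Matrix (Fin n) (Fin n) F, (A.charpoly.rootSet F).ncard ≤ n - 1 →
        MvPolynomial.eval (fun p => A p.1 p.2) f = 0) ↔ f ∈ Ideal.span {D}) := by
  have hinj : ∀ (A : Matrix (Fin n) (Fin n) F) (lam : Fin n → F),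
      A.charpoly = ∏ i, (Polynomial.X - Polynomial.C (lam i)) →
      (MvPolynomial.eval (fun p => A p.1 p.2) D = 0 ↔ ¬ Function.Injective lam) := by
    intro A lam h
    rw [hD A lam h, Finset.prod_eq_zero_iff]
    constructor
    · rintro ⟨p, hp, h0⟩ hl
      exact (Finset.mem_filter.mp hp).2.ne
        (hl (sub_eq_zero.mp (pow_eq_zero_iff two_ne_zero |>.mp h0)))
    · intro hl
      simp only [Function.Injective, not_forall] at hl
      obtain ⟨a, b, hab, hne⟩ := hl
      rcases lt_or_gt_of_ne hne with h' | h'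
      · exact ⟨(a, b), by simpa using h', by simp [hab]⟩
      · exact ⟨(b, a), by simpa using h', by simp [hab]⟩
  have hlocus : ∀ A : Matrix (Fin n) (Fin n) F, (A.charpoly.rootSet F).ncard ≤ n - 1 ↔
      MvPolynomial.eval (fun p => A p.1 p.2) D = 0 := by
    intro A
    obtain ⟨lam, h⟩ := A.exists_charpoly_eq_prod
    rw [hinj A lam h]
    exact Matrix.mem_repeatedEigenvalueLocus_iff (by omega) h
  have hD0 : D ≠ 0 := by
    intro h0
    have := hinj (Matrix.diagonal fun i : Fin n => ((i : ℕ) : F)) _ (Matrix.charpoly_diagonal _)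
    refine this.mp (by simp [h0]) fun a b hab => Fin.ext (Nat.cast_injective hab)
  have hDdeg : D.totalDegree ≤ n * (n - 1) := by
    refine D.totalDegree_le_of_eval_smul _ fun t a => ?_
    obtain ⟨lam, h⟩ := (Matrix.of fun i j => a (i, j)).exists_charpoly_eq_prod
    have h1 := hD _ _ h
    have h2 := hD _ _ (Matrix.charpoly_smul_eq_prod t h)
    simp only [Matrix.smul_apply, Matrix.of_apply, smul_eq_mul, ← mul_sub, mul_pow,
      Finset.prod_mul_distrib, Finset.prod_const] at h1 h2
    rw [h1, h2, ← pow_mul, Matrix.two_mul_card_filter_lt]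
  have hmin : ∀ f : MvPolynomial (Fin n × Fin n) F, f ≠ 0 →
      (∀ A : Matrix (Fin n) (Fin n) F, (A.charpoly.rootSet F).ncard ≤ n - 1 →
        MvPolynomial.eval (fun p => A p.1 p.2) f = 0) → n * (n - 1) ≤ f.totalDegree := by
    intro f hf0 hf
    obtain ⟨a, ha⟩ : ∃ a, MvPolynomial.eval a (f * D) ≠ 0 := by
      by_contra! h0
      exact mul_ne_zero hf0 hD0 (MvPolynomial.funext (by simpa using h0))
    rw [map_mul] at ha
    obtain ⟨lam, h⟩ := (Matrix.of fun i j => a (i, j)).exists_charpoly_eq_prod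
    exact Matrix.le_totalDegree_of_eval_ne_zero hf h
      (not_not.mp fun hl => right_ne_zero_of_mul ha ((hinj _ _ h).mpr hl))
      (left_ne_zero_of_mul ha)
  have hsq : Squarefree D := by
    rintro g ⟨k, rfl⟩
    have hg0 : g ≠ 0 := by rintro rfl; simp at hD0
    have hk0 : k ≠ 0 := by rintro rfl; simp at hD0
    have hle := hmin (g * k) (mul_ne_zero hg0 hk0) fun A hA => by
      have := (hlocus A).mp hA
      simp only [map_mul, mul_eq_zero] at this ⊢
      tauto
    rw [mul_assoc, MvPolynomial.totalDegree_mul_of_isDomain hg0 (mul_ne_zero hg0 hk0)] at hDdeg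
    rw [MvPolynomial.totalDegree_eq_zero_iff_eq_C.mp (by omega : g.totalDegree = 0)] at hg0 ⊢
    exact (IsUnit.mk0 _ fun h => hg0 (by rw [h, map_zero])).map MvPolynomial.C
  refine ⟨hmin, fun f => ⟨fun hf => ?_, fun hf A hA => ?_⟩⟩
  · have hrad : f ∈ (Ideal.span {D}).radical := by
      rw [← MvPolynomial.vanishingIdeal_zeroLocus_eq_radical (K := F)]
      intro a ha
      have hDa : MvPolynomial.eval a D = 0 := ha D (Ideal.mem_span_singleton_self D)
      exact hf (Matrix.of fun i j => a (i, j)) ((hlocus _).mpr hDa)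
    obtain ⟨m, hm⟩ := hrad
    rw [Ideal.mem_span_singleton] at hm ⊢
    exact hsq.isRadical m f hm
  · obtain ⟨g, rfl⟩ := Ideal.mem_span_singleton.mp hf
    rw [map_mul, (hlocus A).mp hA, zero_mul]
end
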